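/- The S-cofibrant replacement of a flow is unique up to S-homotopy: if X' and X'' are S-cofibrant flows each equipped with a weak S-homotopy equivalence to the same flow X, then X' and X'' are S-homotopy equivalent. -/

import Mathlib

open CategoryTheory

namespace Gaucher

/-- Helper: any map out of an empty space is continuous. -/
theorem continuous_of_isEmpty {α β : Type*} [TopologicalSpace α] [TopologicalSpace β]
    [IsEmpty α] (f : α → β) : Continuous f :=
  ⟨fun s _ => by rw [Set.eq_empty_of_isEmpty (f ⁻¹' s)]; exact isOpen_empty⟩

/-- Helper: fibers of constant maps are open. -/
theorem isOpen_preimage_const {α β : Type*} [TopologicalSpace α] (b a : β) :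
    IsOpen ((fun _ : α => b) ⁻¹' {a}) := by
  rcases eq_or_ne b a with h | h
  · rw [Set.preimage_const_of_mem (by simpa using h)]; exact isOpen_univ
  · rw [Set.preimage_const_of_notMem (by simpa using h)]; exact isOpen_empty

/-- A flow (Gaucher): a set of states (with the discrete topology), a topological
space of (non-constant) execution paths, source and target maps which are continuous
(i.e. have open fibers, the state set being discrete), and a continuous, associative
partial composition defined on composable pairs of paths. -/
structure Flow : Type 1 where
  /-- the `0`-skeleton, i.e. the set of states -/
  State : Type
  /-- the space of non-constant execution paths -/
  Path : Type
  [topPath : TopologicalSpace Path]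
  /-- source map -/
  s : Path → State
  /-- target map -/
  t : Path → State
  isOpen_preimage_s : ∀ a : State, IsOpen (s ⁻¹' {a})
  isOpen_preimage_t : ∀ a : State, IsOpen (t ⁻¹' {a})
  /-- composition of composable paths -/
  comp : ∀ x y : Path, t x = s y → Path
  continuous_comp : Continuous (fun p : { p : Path × Path // t p.1 = s p.2 } =>
    comp p.1.1 p.1.2 p.2)
  s_comp : ∀ x y h, s (comp x y h) = s x
  t_comp : ∀ x y h, t (comp x y h) = t y
  comp_assoc : ∀ (x y z : Path) (hxy : t x = s y) (hyz : t y = s z)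
    (h₁ : t x = s (comp y z hyz)) (h₂ : t (comp x y hxy) = s z),
    comp x (comp y z hyz) h₁ = comp (comp x y hxy) z h₂

attribute [instance] Flow.topPath

/-- The state set of a flow carries the discrete topology. -/
instance Flow.topState (X : Flow) : TopologicalSpace X.State := ⊥

instance (X : Flow) : DiscreteTopology X.State := ⟨rfl⟩

/-- A morphism of flows: a map preserving states, paths, sources, targets and
composition, continuous on the path spaces (continuity on the discrete state part
being automatic). -/
structure FlowHom (X Y : Flow) : Type where
  toFun0 : X.State → Y.State
  toFunP : X.Path → Y.Path
  continuous_toFunP : Continuous toFunP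
  s_map : ∀ x, Y.s (toFunP x) = toFun0 (X.s x)
  t_map : ∀ x, Y.t (toFunP x) = toFun0 (X.t x)
  comp_map : ∀ x y (h : X.t x = X.s y) (h' : Y.t (toFunP x) = Y.s (toFunP y)),
    toFunP (X.comp x y h) = Y.comp (toFunP x) (toFunP y) h'

theorem FlowHom.ext {X Y : Flow} {f g : FlowHom X Y}
    (h0 : f.toFun0 = g.toFun0) (hP : f.toFunP = g.toFunP) : f = g := by
  cases f; cases g; cases h0; cases hP; rfl

/-- The identity morphism of flows. -/
def FlowHom.id (X : Flow) : FlowHom X X where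
  toFun0 := _root_.id
  toFunP := _root_.id
  continuous_toFunP := continuous_id
  s_map _ := rfl
  t_map _ := rfl
  comp_map _ _ _ _ := rfl

/-- Composition of morphisms of flows (`g.comp f` is `g ∘ f`). -/
def FlowHom.comp {X Y Z : Flow} (g : FlowHom Y Z) (f : FlowHom X Y) : FlowHom X Z where
  toFun0 := g.toFun0 ∘ f.toFun0
  toFunP := g.toFunP ∘ f.toFunP
  continuous_toFunP := g.continuous_toFunP.comp f.continuous_toFunP
  s_map x := by simp only [Function.comp_apply, g.s_map, f.s_map]
  t_map x := by simp only [Function.comp_apply, g.t_map, f.t_map]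
  comp_map x y h h' := by
    have hY : Y.t (f.toFunP x) = Y.s (f.toFunP y) := by
      rw [f.t_map, f.s_map, h]
    show g.toFunP (f.toFunP (X.comp x y h)) = _
    rw [f.comp_map x y h hY, g.comp_map _ _ hY h']
    rfl

/-- The category `Flow` of flows. -/
instance : Category Flow where
  Hom := FlowHom
  id := FlowHom.id
  comp f g := g.comp f
  id_comp f := FlowHom.ext rfl rfl
  comp_id f := FlowHom.ext rfl rfl
  assoc f g h := FlowHom.ext rfl rfl

theorem FlowHom.comp_assoc {W X Y Z : Flow} (h : FlowHom Y Z) (g : FlowHom X Y)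
    (f : FlowHom W X) : (h.comp g).comp f = h.comp (g.comp f) :=
  FlowHom.ext rfl rfl

/-- The flow `Glob Z` associated to a topological space `Z`: two states `0` and `1`,
path space `Z`, every path going from `0` to `1` (no two paths are composable). -/
def Glob (Z : Type) [TopologicalSpace Z] : Flow where
  State := Fin 2
  Path := Z
  s := fun _ => 0
  t := fun _ => 1
  isOpen_preimage_s := fun a => isOpen_preimage_const _ a
  isOpen_preimage_t := fun a => isOpen_preimage_const _ a
  comp := fun _ _ h => absurd (show (1 : Fin 2) = 0 from h) (by decide)
  continuous_comp := by
    haveI : IsEmpty { p : Z × Z // (fun _ : Z => (1 : Fin 2)) p.1 = (fun _ : Z => (0 : Fin 2)) p.2 } :=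
      ⟨fun p => absurd (show (1 : Fin 2) = 0 from p.2) (by decide)⟩
    exact continuous_of_isEmpty _
  s_comp := fun x y h => absurd (show (1 : Fin 2) = 0 from h) (by decide)
  t_comp := fun x y h => absurd (show (1 : Fin 2) = 0 from h) (by decide)
  comp_assoc := fun x y z hxy => absurd (show (1 : Fin 2) = 0 from hxy) (by decide)

/-- Functoriality of `Glob`. -/
def Glob.map {Z W : Type} [TopologicalSpace Z] [TopologicalSpace W] (f : C(Z, W)) :
    FlowHom (Glob Z) (Glob W) where
  toFun0 := _root_.id
  toFunP := f
  continuous_toFunP := f.continuous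
  s_map _ := rfl
  t_map _ := rfl
  comp_map x y h := absurd (show (1 : Fin 2) = 0 from h) (by decide)

/-- The directed segment `I⃗` is `Glob` of a one-point space. -/
def dirSegment : Flow := Glob PUnit

/-- The flow with exactly one state and no non-constant execution path. -/
def pointFlow : Flow where
  State := PUnit
  Path := Empty
  s := fun e => e.elim
  t := fun e => e.elim
  isOpen_preimage_s := fun a => by
    rw [Set.eq_empty_of_isEmpty (_ ⁻¹' {a})]; exact isOpen_empty
  isOpen_preimage_t := fun a => by
    rw [Set.eq_empty_of_isEmpty (_ ⁻¹' {a})]; exact isOpen_empty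
  comp := fun x _ _ => x.elim
  continuous_comp := continuous_of_isEmpty _
  s_comp := fun x => x.elim
  t_comp := fun x => x.elim
  comp_assoc := fun x => x.elim

-- PART B (appended after part A) : S-homotopy, weak homotopy equivalences

/-- Two morphisms of flows `f g : X → Y` are S-homotopic: there is a continuous map
`H : (X⁰ ⊔ ℙX) × [0,1] → Y⁰ ⊔ ℙY` such that every `H(-,u)` is a morphism of flows,
`H(-,0) = f` and `H(-,1) = g`.  (Continuity of `H` on the two summands `ℙX × [0,1]`
and `X⁰ × [0,1]` — the state sets carrying the discrete topology — is exactly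
continuity of the two maps below.) -/
def SHomotopy {X Y : Flow} (f g : FlowHom X Y) : Prop :=
  ∃ F : unitInterval → FlowHom X Y,
    F 0 = f ∧ F 1 = g ∧
    Continuous (fun p : X.Path × unitInterval => (F p.2).toFunP p.1) ∧
    Continuous (fun p : X.State × unitInterval => (F p.2).toFun0 p.1)

/-- A morphism of flows is an S-homotopy equivalence if it admits an inverse up to
S-homotopy. -/
def IsSHomotopyEquiv {X Y : Flow} (f : FlowHom X Y) : Prop :=
  ∃ g : FlowHom Y X, SHomotopy (f.comp g) (FlowHom.id Y) ∧ SHomotopy (g.comp f) (FlowHom.id X)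

/-- Two flows are S-homotopy equivalent. -/
def SHomotopyEquivalent (X Y : Flow) : Prop :=
  ∃ f : FlowHom X Y, IsSHomotopyEquiv f

/-- The underlying continuous map on path spaces of a morphism of flows. -/
def FlowHom.pathMap {X Y : Flow} (f : FlowHom X Y) : C(X.Path, Y.Path) :=
  ⟨f.toFunP, f.continuous_toFunP⟩

/-- The map induced by a continuous map on `π₀` (path components). -/
def pi0Map {A B : Type*} [TopologicalSpace A] [TopologicalSpace B] (h : C(A, B)) :
    ZerothHomotopy A → ZerothHomotopy B :=
  Quotient.map h (fun _ _ j => ⟨j.somePath.map h.continuous⟩)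

/-- Push forward a generalized loop along a continuous map. -/
def GenLoop.push {A B : Type*} [TopologicalSpace A] [TopologicalSpace B] (h : C(A, B))
    {N : Type*} {x : A} (p : GenLoop N A x) : GenLoop N B (h x) :=
  ⟨h.comp p.1, fun y hy => by
    simp only [ContinuousMap.comp_apply]
    exact congrArg h (p.2 y hy)⟩

/-- The map induced by a continuous map on the `N`-th homotopy group. -/
def piMap {A B : Type*} [TopologicalSpace A] [TopologicalSpace B] (h : C(A, B))
    (N : Type*) (x : A) : HomotopyGroup N A x → HomotopyGroup N B (h x) :=
  Quotient.map (GenLoop.push h) (fun _ _ H =>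
    ⟨(Nonempty.some H).compContinuousMap h⟩)

/-- A continuous map is a weak homotopy equivalence: it induces a bijection on path
components and, for every base point and every `n`, a bijection on `πₙ`. -/
def IsWeakHomotopyEquiv {A B : Type*} [TopologicalSpace A] [TopologicalSpace B]
    (h : C(A, B)) : Prop :=
  Function.Bijective (pi0Map h) ∧
    ∀ (x : A) (n : ℕ), Function.Bijective (piMap h (Fin n) x)

/-- A morphism of flows is a weak S-homotopy equivalence if it induces a bijection
on the `0`-skeletons and a weak homotopy equivalence on the path spaces. -/
def IsWeakSHomotopyEquiv {X Y : Flow} (f : FlowHom X Y) : Prop :=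
  Function.Bijective f.toFun0 ∧ IsWeakHomotopyEquiv f.pathMap

-- PART C : S-cofibrant flows

/-- The sphere `S^{n-1}`, boundary of the closed `n`-disk `D^n`. -/
abbrev diskBoundary (n : ℕ) : Type := Metric.sphere (0 : EuclideanSpace ℝ (Fin n)) 1

/-- The closed `n`-disk `D^n`. -/
abbrev closedDisk (n : ℕ) : Type := Metric.closedBall (0 : EuclideanSpace ℝ (Fin n)) 1

/-- The inclusion `S^{n-1} ⊆ D^n`. -/
noncomputable def diskBoundaryInclusion (n : ℕ) : C(diskBoundary n, closedDisk n) :=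
  ⟨fun p => ⟨p.1, Metric.sphere_subset_closedBall p.2⟩,
    Continuous.subtype_mk continuous_subtype_val _⟩

/-- The inclusion of flows `Glob (S^{n-1}) → Glob (D^n)`. -/
noncomputable def globBoundaryInclusion (n : ℕ) : FlowHom (Glob (diskBoundary n)) (Glob (closedDisk n)) :=
  Glob.map (diskBoundaryInclusion n)

/-- A witness that a flow `X` is S-cofibrant: a skeletal filtration `sk 0 → sk 1 → ⋯`
where `sk 0` has empty path space (it is purely a discrete set of states), where
`sk (n+1)` is obtained from `sk n` as the pushout (expressed by its universal property,
`attach_isPushout`) of `⊔ᵢ Glob (S^{n-1}) → ⊔ᵢ Glob (D^n)` along attaching morphisms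
`Glob (S^{n-1}) → sk n` (for `n = 0` this attaches copies of the directed segment
`I⃗ = Glob(D⁰)` along `Glob(S^{-1}) = Glob(∅)`), and where `X` is the colimit
(expressed by its universal property `isColimit`) of the `sk n`. -/
structure SCofibrantStructure (X : Flow) : Type 1 where
  sk : ℕ → Flow
  isEmpty_path_sk_zero : IsEmpty (sk 0).Path
  ι : ∀ n, FlowHom (sk n) (sk (n + 1))
  cells : ℕ → Type
  attachMap : ∀ n, cells n → FlowHom (Glob (diskBoundary n)) (sk n)
  cellMap : ∀ n, cells n → FlowHom (Glob (closedDisk n)) (sk (n + 1))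
  attach_comm : ∀ n (i : cells n),
    (cellMap n i).comp (globBoundaryInclusion n) = (ι n).comp (attachMap n i)
  attach_isPushout : ∀ n (Z : Flow) (g : FlowHom (sk n) Z)
    (k : cells n → FlowHom (Glob (closedDisk n)) Z),
    (∀ i, (k i).comp (globBoundaryInclusion n) = g.comp (attachMap n i)) →
    ∃! h : FlowHom (sk (n + 1)) Z, h.comp (ι n) = g ∧ ∀ i, h.comp (cellMap n i) = k i
  incl : ∀ n, FlowHom (sk n) X
  incl_comm : ∀ n, (incl (n + 1)).comp (ι n) = incl n
  isColimit : ∀ (Z : Flow) (d : ∀ n, FlowHom (sk n) Z),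
    (∀ n, (d (n + 1)).comp (ι n) = d n) →
    ∃! h : FlowHom X Z, ∀ n, h.comp (incl n) = d n

/-- A flow is S-cofibrant if it admits a skeletal filtration as above. -/
def SCofibrant (X : Flow) : Prop :=
  Nonempty (SCofibrantStructure X)

-- PART D : the flow U ⊠ X, S-cofibrations, NDR pairs, the space FLOW(X,Y)

/-- The data exhibiting a flow `B` as a candidate for `U ⊠ X` (`U` a topological
space, `X` a flow): the generators, i.e. the states of `X` and a continuous family
`η (u, x)` of paths indexed by `U × ℙX`, subject to the defining relations
`s(u ⊠ x) = s x`, `t(u ⊠ x) = t x` and `(u ⊠ x) * (u ⊠ y) = u ⊠ (x * y)`. -/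
structure BoxCocone (U : Type) [TopologicalSpace U] (X B : Flow) : Type where
  η0 : X.State → B.State
  η : U × X.Path → B.Path
  continuous_η : Continuous η
  s_η : ∀ u x, B.s (η (u, x)) = η0 (X.s x)
  t_η : ∀ u x, B.t (η (u, x)) = η0 (X.t x)
  comp_η : ∀ u x y (h : X.t x = X.s y) (h' : B.t (η (u, x)) = B.s (η (u, y))),
    B.comp (η (u, x)) (η (u, y)) h' = η (u, X.comp x y h)

/-- `B`, equipped with the data `c`, *is* the flow `U ⊠ X`, i.e. the free flow
generated by `X⁰ ⊔ (U × ℙX)` quotiented by the relations `s (u,x) = s x`,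
`t (u,x) = t x` and `(u,x) * (u,y) = (u, x*y)`: every flow `Z` equipped with such
data receives a unique morphism of flows from `B` compatible with the data. -/
def IsBoxTimes {U : Type} [TopologicalSpace U] {X B : Flow} (c : BoxCocone U X B) : Prop :=
  ∀ (Z : Flow) (d : BoxCocone U X Z),
    ∃! f : FlowHom B Z, f.toFun0 ∘ c.η0 = d.η0 ∧ f.toFunP ∘ c.η = d.η

/-- For `u ∈ U`, the morphism of flows `X → U ⊠ X`, `x ↦ u ⊠ x`. -/
def BoxCocone.atTime {U : Type} [TopologicalSpace U] {X B : Flow}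
    (c : BoxCocone U X B) (u : U) : FlowHom X B where
  toFun0 := c.η0
  toFunP := fun x => c.η (u, x)
  continuous_toFunP := c.continuous_η.comp (Continuous.prodMk_right u)
  s_map x := c.s_η u x
  t_map x := c.t_η u x
  comp_map x y h h' := (c.comp_η u x y h h').symm

/-- Given box-product data `c : BoxCocone U A BUA` and `c' : BoxCocone V X BVX`, a
continuous map `φ : U → V` and a morphism of flows `f : A → X`, this asserts that
`m : BUA → BVX` is the canonically induced morphism `φ ⊠ f`, i.e. `u ⊠ a ↦ φ u ⊠ f a`. -/
def IsInducedBoxHom {U V : Type} [TopologicalSpace U] [TopologicalSpace V]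
    {A X BUA BVX : Flow} (c : BoxCocone U A BUA) (c' : BoxCocone V X BVX)
    (φ : U → V) (f : FlowHom A X) (m : FlowHom BUA BVX) : Prop :=
  (∀ a, m.toFun0 (c.η0 a) = c'.η0 (f.toFun0 a)) ∧
  (∀ u x, m.toFunP (c.η (u, x)) = c'.η (φ u, f.toFunP x))

/-- A morphism of flows `i : A → X` is an S-cofibration if it satisfies the
S-homotopy extension property: for every realization of `[0,1] ⊠ A` and `[0,1] ⊠ X`,
every morphism `g : X → Z` and every S-homotopy `H : [0,1] ⊠ A → Z` starting at
`g ∘ i`, there is an S-homotopy `H̄ : [0,1] ⊠ X → Z` with `H̄(u ⊠ i x) = H(u ⊠ x)`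
and `H̄(0 ⊠ y) = g y`. -/
def IsSCofibration {A X : Flow} (i : FlowHom A X) : Prop :=
  ∀ (IA IX : Flow) (cA : BoxCocone unitInterval A IA) (cX : BoxCocone unitInterval X IX),
    IsBoxTimes cA → IsBoxTimes cX →
    ∀ (Z : Flow) (g : FlowHom X Z) (H : FlowHom IA Z),
      H.comp (cA.atTime 0) = g.comp i →
      ∃ Hbar : FlowHom IX Z,
        (∀ u : unitInterval, (Hbar.comp ((cX.atTime u).comp i)) = H.comp (cA.atTime u)) ∧
        Hbar.comp (cX.atTime 0) = g

/-- `(Y, B)` is an NDR pair: `B` is closed in `Y` and there are `u : Y → [0,1]` with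
`B = u⁻¹(0)` and a homotopy `h : Y × [0,1] → Y` with `h(y,0) = y`, `h(b,t) = b` for
`b ∈ B`, and `h(y,1) ∈ B` as soon as `u y < 1`. -/
def IsNDRPair {Y : Type} [TopologicalSpace Y] (B : Set Y) : Prop :=
  IsClosed B ∧ ∃ (u : C(Y, unitInterval)) (h : C(Y × unitInterval, Y)),
    B = {y | u y = 0} ∧
    (∀ y, h (y, 0) = y) ∧
    (∀ b ∈ B, ∀ t, h (b, t) = b) ∧
    (∀ y, (u y : ℝ) < 1 → h (y, 1) ∈ B)

/-- `(Y, B)` is a DR pair: as for an NDR pair, but with `u y < 1` everywhere, so that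
`B` is a deformation retract of `Y`. -/
def IsDRPair {Y : Type} [TopologicalSpace Y] (B : Set Y) : Prop :=
  IsClosed B ∧ ∃ (u : C(Y, unitInterval)) (h : C(Y × unitInterval, Y)),
    B = {y | u y = 0} ∧
    (∀ y, h (y, 0) = y) ∧
    (∀ b ∈ B, ∀ t, h (b, t) = b) ∧
    (∀ y, (u y : ℝ) < 1 → h (y, 1) ∈ B) ∧
    (∀ y, (u y : ℝ) < 1)

/-- A morphism of flows, as a continuous map `X⁰ ⊔ ℙX → Y⁰ ⊔ ℙY`. -/
def FlowHom.toSumMap {X Y : Flow} (f : FlowHom X Y) :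
    C(X.State ⊕ X.Path, Y.State ⊕ Y.Path) :=
  ⟨Sum.map f.toFun0 f.toFunP,
    (continuous_of_discreteTopology (α := X.State)).sumMap f.continuous_toFunP⟩

/-- The set of morphisms of flows from `X` to `Y` carries the topology induced, via
`FlowHom.toSumMap`, by the compact-open topology. -/
def flowHomInducedTop (X Y : Flow) : TopologicalSpace (FlowHom X Y) :=
  TopologicalSpace.induced FlowHom.toSumMap ContinuousMap.compactOpen

/-- The space `FLOW(X,Y)`: morphisms of flows with the Kelleyfication of the induced
compact-open topology. -/
instance FlowHom.topologicalSpace (X Y : Flow) : TopologicalSpace (FlowHom X Y) :=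
  @TopologicalSpace.compactlyGenerated.{0} (FlowHom X Y) (flowHomInducedTop X Y)

-- PART E : model structures, localization, limits machinery

/-- The class of weak S-homotopy equivalences, as a class of morphisms of the
category `Flow`. -/
def weakSHomotopyEquivalences : MorphismProperty Flow :=
  fun _ _ f => IsWeakSHomotopyEquiv f

/-- `f` is a retract of `g` in the arrow category. -/
def IsRetractOfHom {C : Type*} [Category C] {X Y Z W : C} (f : X ⟶ Y) (g : Z ⟶ W) : Prop :=
  ∃ (i : X ⟶ Z) (r : Z ⟶ X) (i' : Y ⟶ W) (r' : W ⟶ Y),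
    i ≫ r = 𝟙 X ∧ i' ≫ r' = 𝟙 Y ∧ i ≫ g = f ≫ i' ∧ g ≫ r' = r ≫ f

/-- A model category structure (Quillen) on a category `C`: three classes of
morphisms — weak equivalences, cofibrations and fibrations — satisfying
two-out-of-three, stability under retracts, the lifting axioms and the
factorization axioms. -/
structure ModelStructure (C : Type*) [Category C] where
  weq : MorphismProperty C
  cof : MorphismProperty C
  fib : MorphismProperty C
  weq_two_out_of_three : weq.HasTwoOutOfThreeProperty
  weq_retract : ∀ {X Y Z W : C} (f : X ⟶ Y) (g : Z ⟶ W),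
    IsRetractOfHom f g → weq g → weq f
  cof_retract : ∀ {X Y Z W : C} (f : X ⟶ Y) (g : Z ⟶ W),
    IsRetractOfHom f g → cof g → cof f
  fib_retract : ∀ {X Y Z W : C} (f : X ⟶ Y) (g : Z ⟶ W),
    IsRetractOfHom f g → fib g → fib f
  lift_cof_trivFib : ∀ {A B P Q : C} (i : A ⟶ B) (p : P ⟶ Q),
    cof i → fib p → weq p → HasLiftingProperty i p
  lift_trivCof_fib : ∀ {A B P Q : C} (i : A ⟶ B) (p : P ⟶ Q),
    cof i → weq i → fib p → HasLiftingProperty i p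
  fact_cof_trivFib : ∀ {X Y : C} (f : X ⟶ Y),
    ∃ (Z : C) (i : X ⟶ Z) (p : Z ⟶ Y), cof i ∧ fib p ∧ weq p ∧ i ≫ p = f
  fact_trivCof_fib : ∀ {X Y : C} (f : X ⟶ Y),
    ∃ (Z : C) (i : X ⟶ Z) (p : Z ⟶ Y), cof i ∧ weq i ∧ fib p ∧ i ≫ p = f

/-- The S-homotopy relation, as a relation on the morphisms of the full subcategory
of S-cofibrant flows. -/
def sHomotopyHomRel : HomRel (ObjectProperty.FullSubcategory SCofibrant) :=
  fun {_ _} f g => SHomotopy f.hom g.hom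

/-- The canonical map `FLOW(X, lim Yⱼ) → lim FLOW(X, Yⱼ)`, the target being realized
as the subspace of the product `Π j, FLOW(X, Yⱼ)` consisting of the compatible
families. -/
def canonicalMapToLimit (X : Flow) {J : Type} [SmallCategory J] (D : J ⥤ Flow)
    (c : Limits.Cone D) :
    FlowHom X c.pt →
      {p : ∀ j, FlowHom X (D.obj j) // ∀ ⦃j j' : J⦄ (φ : j ⟶ j'),
        (D.map φ).comp (p j) = p j'} :=
  fun g => ⟨fun j => (c.π.app j).comp g, by
    intro j j' φ
    have h := c.π.naturality φ
    have h2 : FlowHom.comp (D.map φ) (c.π.app j) = c.π.app j' := by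
      have h3 := h.symm.trans
        (show ((Functor.const J).obj c.pt).map φ ≫ c.π.app j' = c.π.app j' from
          FlowHom.ext rfl rfl)
      exact h3
    show FlowHom.comp (D.map φ) (FlowHom.comp (c.π.app j) g) = FlowHom.comp (c.π.app j') g
    rw [← FlowHom.comp_assoc, h2]⟩


section MyProof
open Topology unitInterval

/-- homotopy lifting-extension property of `p` against the pair `(B, S)` -/
def LiftPair {Y Z : Type} [TopologicalSpace Y] [TopologicalSpace Z] (p : C(Y, Z))
    {B : Type} [TopologicalSpace B] (S : Set B) : Prop :=
  ∀ (a : C(S, Y)) (k : C(B, Z)) (H : C(S × I, Z)),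
    (∀ s, H (s, 0) = p (a s)) → (∀ s, H (s, 1) = k s.1) →
    ∃ (a' : C(B, Y)) (H' : C(B × I, Z)), (∀ s : S, a' s.1 = a s) ∧
      (∀ (s : S) t, H' (s.1, t) = H (s, t)) ∧ (∀ b, H' (b, 0) = p (a' b)) ∧
      (∀ b, H' (b, 1) = k b)

/-- extension property -/
def ExtPair {Y Z : Type} [TopologicalSpace Y] [TopologicalSpace Z] (p : C(Y, Z))
    {B : Type} [TopologicalSpace B] (S : Set B) : Prop :=
  ∀ (a : C(S, Y)) (k : C(B, Z)), (∀ s, k s.1 = p (a s)) →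
    ∃ a' : C(B, Y), ∀ s : S, a' s.1 = a s

section
variable {Y Z : Type} [TopologicalSpace Y] [TopologicalSpace Z] {p : C(Y, Z)}
  {B B' : Type} [TopologicalSpace B] [TopologicalSpace B'] {S : Set B} {S' : Set B'}

theorem LiftPair.transfer (e : B ≃ₜ B') (he : ∀ x, e x ∈ S' ↔ x ∈ S)
    (h : LiftPair p S') : LiftPair p S := by
  intro a k H h0 h1
  have he' : ∀ x, x ∈ S' → e.symm x ∈ S := fun x hx => by
    rw [← he, e.apply_symm_apply]; exact hx
  let j : C(S', S) := ⟨fun x => ⟨e.symm x.1, he' _ x.2⟩, by fun_prop⟩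
  obtain ⟨a', H', ha, hH, hb0, hb1⟩ := h (a.comp j) (k.comp ⟨e.symm, e.symm.continuous⟩)
    ⟨fun x => H (j x.1, x.2), by fun_prop⟩ (fun s => h0 _) (fun s => h1 _)
  refine ⟨a'.comp ⟨e, e.continuous⟩, ⟨fun x => H' (e x.1, x.2), by fun_prop⟩, ?_, ?_, ?_, ?_⟩
  · intro s
    have := ha ⟨e s.1, (he _).2 s.2⟩
    simp only [ContinuousMap.comp_apply, ContinuousMap.coe_mk, j] at this ⊢
    rw [this]; congr 1; ext; simp
  · intro s t
    have := hH ⟨e s.1, (he _).2 s.2⟩ t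
    simp only [ContinuousMap.coe_mk, j] at this ⊢
    rw [this]; congr 2; ext; simp
  · intro b; simp [hb0]
  · intro b; simp [hb1]

theorem ExtPair.transfer (e : B ≃ₜ B') (he : ∀ x, e x ∈ S' ↔ x ∈ S)
    (h : ExtPair p S') : ExtPair p S := by
  intro a k h0
  have he' : ∀ x, x ∈ S' → e.symm x ∈ S := fun x hx => by
    rw [← he, e.apply_symm_apply]; exact hx
  let j : C(S', S) := ⟨fun x => ⟨e.symm x.1, he' _ x.2⟩, by fun_prop⟩
  obtain ⟨a', ha⟩ := h (a.comp j) (k.comp ⟨e.symm, e.symm.continuous⟩) (fun s => h0 (j s))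
  refine ⟨a'.comp ⟨e, e.continuous⟩, ?_⟩
  intro s
  have := ha ⟨e s.1, (he _).2 s.2⟩
  simp only [ContinuousMap.comp_apply, ContinuousMap.coe_mk, j] at this ⊢
  rw [this]; congr 1; ext; simp
end

theorem bodyPair {V W : Type} [NormedAddCommGroup V] [NormedSpace ℝ V] [FiniteDimensional ℝ V]
    [NormedAddCommGroup W] [NormedSpace ℝ W] [FiniteDimensional ℝ W]
    (hVW : Module.finrank ℝ V = Module.finrank ℝ W) {C : Set V} {D : Set W}
    (hC : Convex ℝ C) (hCi : (interior C).Nonempty) (hCc : IsCompact C)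
    (hD : Convex ℝ D) (hDi : (interior D).Nonempty) (hDc : IsCompact D) :
    ∃ e : C ≃ₜ D, ∀ x, (e x) ∈ {y : D | y.1 ∈ frontier D} ↔ x ∈ {x : C | x.1 ∈ frontier C} := by
  let l : V ≃L[ℝ] W := (LinearEquiv.ofFinrankEq V W hVW).toContinuousLinearEquiv
  have hlC : Convex ℝ (l '' C) := hC.linear_image l.toLinearEquiv.toLinearMap
  have hlCc : IsCompact (l '' C) := hCc.image l.continuous
  have hlCi : (interior (l '' C)).Nonempty := by
    have := l.toHomeomorph.image_interior C
    change l '' interior C = interior (l '' C) at this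
    rw [← this]; exact hCi.image _
  obtain ⟨e, -, h2, h3⟩ := exists_homeomorph_image_eq hlC hlCi
    ((NormedSpace.isVonNBounded_iff ℝ).2 hlCc.isBounded) hD hDi
    ((NormedSpace.isVonNBounded_iff ℝ).2 hDc.isBounded)
  rw [hlCc.isClosed.closure_eq, hDc.isClosed.closure_eq] at h2
  let E : V ≃ₜ W := l.toHomeomorph.trans e
  have hE : E '' C = D := by
    rw [← h2, Set.image_image]; rfl
  have hEf : E '' frontier C = frontier D := by
    rw [E.image_frontier, hE]
  refine ⟨E.sets (by rw [← hE, E.preimage_image]), ?_⟩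
  intro x
  simp only [Set.mem_ofPred_eq]
  change E x.1 ∈ frontier D ↔ _
  rw [← hEf]
  exact E.injective.mem_set_image

section loops
variable {Y Z : Type} [TopologicalSpace Y] [TopologicalSpace Z] {n : ℕ}

/-- the coordinate change from `ℝⁿ` to the cube -/
noncomputable def toCube (v : Fin n → ℝ) : Fin n → I :=
  fun i => Set.projIcc 0 1 zero_le_one ((v i + 1) / 2)

/-- the coordinate change from the cube to `ℝⁿ` -/
noncomputable def ofCube (y : Fin n → I) : Fin n → ℝ := fun i => 2 * (y i : ℝ) - 1

theorem continuous_toCube : Continuous (toCube (n := n)) := by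
  unfold toCube
  refine continuous_pi fun i => continuous_projIcc.comp ?_
  fun_prop

theorem continuous_ofCube : Continuous (ofCube (n := n)) := by
  unfold ofCube; fun_prop

theorem ofCube_toCube {v : Fin n → ℝ} (hv : ‖v‖ ≤ 1) : ofCube (toCube v) = v := by
  ext i
  have h := abs_le.1 ((norm_le_pi_norm v i).trans hv)
  unfold ofCube toCube
  rw [Set.projIcc_of_mem _ (⟨by linarith [h.1], by linarith [h.2]⟩ : (v i + 1) / 2 ∈ Set.Icc (0:ℝ) 1)]
  simp only; ring

theorem toCube_ofCube (y : Fin n → I) : toCube (ofCube y) = y := by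
  ext i
  unfold ofCube toCube
  have : (2 * (y i : ℝ) - 1 + 1) / 2 = y i := by ring
  rw [this, Set.projIcc_val]

theorem norm_ofCube_le (y : Fin n → I) : ‖ofCube y‖ ≤ 1 := by
  rw [pi_norm_le_iff_of_nonneg zero_le_one]
  intro i
  have h0 := (y i).2.1
  have h1 := (y i).2.2
  unfold ofCube
  rw [Real.norm_eq_abs, abs_le]; constructor <;> linarith

theorem norm_ofCube_boundary {y : Fin n → I} (hy : y ∈ Cube.boundary (Fin n)) :
    ‖ofCube y‖ = 1 := by
  apply le_antisymm (norm_ofCube_le y)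
  obtain ⟨i, hi⟩ := hy
  refine le_trans ?_ (norm_le_pi_norm _ i)
  unfold ofCube
  rcases hi with h | h <;> rw [h] <;> norm_num

theorem toCube_boundary {v : Fin n → ℝ} (hv : 1 ≤ ‖v‖) : toCube v ∈ Cube.boundary (Fin n) := by
  by_contra hcon
  have : ‖v‖ < 1 := by
    rw [pi_norm_lt_iff zero_lt_one]
    intro i
    rw [Real.norm_eq_abs]
    by_contra h
    rw [not_lt, le_abs] at h
    apply hcon
    refine ⟨i, ?_⟩
    unfold toCube
    rcases h with h | h
    · right; exact Set.projIcc_of_right_le _ (by linarith)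
    · left; exact Set.projIcc_of_le_left _ (by linarith)
  linarith

theorem loop_surj (p : C(Y, Z)) (hp : IsWeakHomotopyEquiv p) (y0 : Y) (f : C(Fin n → ℝ, Z))
    (hf : ∀ v, ‖v‖ = 1 → f v = p y0) :
    ∃ (β : C(Fin n → ℝ, Y)) (Θ : C((Fin n → ℝ) × ℝ, Z)),
      (∀ v, 1 ≤ ‖v‖ → β v = y0) ∧ (∀ v t, 1 ≤ ‖v‖ → Θ (v, t) = p y0) ∧
      (∀ v, Θ (v, 0) = p (β v)) ∧ (∀ v, ‖v‖ ≤ 1 → Θ (v, 1) = f v) := by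
  let F : GenLoop (Fin n) Z (p y0) := ⟨f.comp ⟨ofCube, continuous_ofCube⟩, fun y hy =>
    hf _ (norm_ofCube_boundary hy)⟩
  obtain ⟨q, hq⟩ := (hp.2 y0 n).2 (Quotient.mk _ F)
  induction q using Quotient.inductionOn with | _ b => ?_
  obtain ⟨G⟩ : GenLoop.Homotopic (GenLoop.push p b) F := Quotient.exact hq
  refine ⟨b.1.comp ⟨toCube, continuous_toCube⟩,
    ⟨fun x => G (Set.projIcc 0 1 zero_le_one x.2, toCube x.1), ?_⟩, ?_, ?_, ?_, ?_⟩
  · exact G.continuous.comp ((continuous_projIcc.comp continuous_snd).prodMk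
      (continuous_toCube.comp continuous_fst))
  · intro v hv; exact b.2 _ (toCube_boundary hv)
  · intro v t hv
    have := G.eq_fst (Set.projIcc 0 1 zero_le_one t) (toCube_boundary hv)
    exact this.trans ((GenLoop.push p b).2 _ (toCube_boundary hv))
  · intro v
    simp only [ContinuousMap.coe_mk, Set.projIcc_left]
    exact G.apply_zero _
  · intro v hv
    simp only [ContinuousMap.coe_mk, Set.projIcc_right]
    refine (G.apply_one _).trans ?_
    change f (ofCube (toCube v)) = _
    rw [ofCube_toCube hv]

theorem loop_inj (p : C(Y, Z)) (hp : IsWeakHomotopyEquiv p) (y0 : Y) (b : C(Fin n → ℝ, Y))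
    (hb : ∀ v, ‖v‖ = 1 → b v = y0) (Ψ : C((Fin n → ℝ) × ℝ, Z))
    (h0 : ∀ v, ‖v‖ ≤ 1 → Ψ (v, 0) = p (b v)) (h1 : ∀ v, ‖v‖ ≤ 1 → Ψ (v, 1) = p y0)
    (hs : ∀ v t, ‖v‖ = 1 → Ψ (v, t) = p y0) :
    ∃ N : C((Fin n → ℝ) × ℝ, Y), (∀ v, ‖v‖ ≤ 1 → N (v, 0) = b v) ∧ (∀ v, N (v, 1) = y0) ∧
      (∀ v t, 1 ≤ ‖v‖ → N (v, t) = y0) := by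
  let F : GenLoop (Fin n) Y y0 := ⟨b.comp ⟨ofCube, continuous_ofCube⟩, fun y hy =>
    hb _ (norm_ofCube_boundary hy)⟩
  let K : GenLoop (Fin n) Y y0 := ⟨ContinuousMap.const _ y0, fun y hy => rfl⟩
  have hFK : piMap p (Fin n) y0 (Quotient.mk _ F) = piMap p (Fin n) y0 (Quotient.mk _ K) := by
    refine Quotient.sound ?_
    refine ⟨⟨⟨⟨fun x => Ψ (ofCube x.2, x.1), ?_⟩, ?_, ?_⟩, ?_⟩⟩
    · exact Ψ.continuous.comp ((continuous_ofCube.comp continuous_snd).prodMk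
        (continuous_subtype_val.comp continuous_fst))
    · intro x; exact h0 _ (norm_ofCube_le x)
    · intro x; exact h1 _ (norm_ofCube_le x)
    · intro t y hy
      refine (hs _ _ (norm_ofCube_boundary hy)).trans ?_
      exact ((GenLoop.push p F).2 _ hy).symm
  obtain ⟨G⟩ : GenLoop.Homotopic F K := Quotient.exact ((hp.2 y0 n).1 hFK)
  refine ⟨⟨fun x => G (Set.projIcc 0 1 zero_le_one x.2, toCube x.1), ?_⟩, ?_, ?_, ?_⟩
  · exact G.continuous.comp ((continuous_projIcc.comp continuous_snd).prodMk
      (continuous_toCube.comp continuous_fst))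
  · intro v hv
    simp only [ContinuousMap.coe_mk, Set.projIcc_left]
    refine (G.apply_zero _).trans ?_
    change b (ofCube (toCube v)) = _
    rw [ofCube_toCube hv]
  · intro v
    simp only [ContinuousMap.coe_mk, Set.projIcc_right]
    exact G.apply_one _
  · intro v t hv
    have := G.eq_fst (Set.projIcc 0 1 zero_le_one t) (toCube_boundary hv)
    exact this.trans (F.2 _ (toCube_boundary hv))
end loops


/-- radial retraction to the unit ball -/
noncomputable def clamp {V : Type} [NormedAddCommGroup V] [NormedSpace ℝ V] (v : V) : V :=
  (max 1 ‖v‖)⁻¹ • v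

section
variable {V : Type} [NormedAddCommGroup V] [NormedSpace ℝ V]

@[fun_prop]
theorem continuous_clamp : Continuous (clamp (V := V)) := by
  unfold clamp
  refine Continuous.smul (Continuous.inv₀ (by fun_prop) ?_) continuous_id
  intro x; positivity

theorem clamp_of_le {v : V} (h : ‖v‖ ≤ 1) : clamp v = v := by
  unfold clamp; rw [max_eq_left h]; simp

theorem norm_clamp_le (v : V) : ‖clamp v‖ ≤ 1 := by
  unfold clamp
  rw [norm_smul, norm_inv, Real.norm_eq_abs, abs_of_pos (by positivity), inv_mul_le_iff₀ (by positivity)]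
  simp

theorem norm_clamp_of_ge {v : V} (h : 1 ≤ ‖v‖) : ‖clamp v‖ = 1 := by
  unfold clamp
  rw [max_eq_right h, norm_smul, norm_inv, norm_norm, inv_mul_cancel₀ (by linarith)]
end

section ext
variable {Y Z : Type} [TopologicalSpace Y] [TopologicalSpace Z] {n : ℕ}

/-- dimension one -/
theorem ext_one (p : C(Y, Z)) (hp : IsWeakHomotopyEquiv p) :
    ExtPair p {x : Set.Icc (0:ℝ) 1 | x.1 ∈ frontier (Set.Icc (0:ℝ) 1)} := by
  rw [frontier_Icc zero_le_one]
  intro a k h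
  have hm0 : (0 : I) ∈ {x : Set.Icc (0:ℝ) 1 | x.1 ∈ ({0, 1} : Set ℝ)} := by simp
  have hm1 : (1 : I) ∈ {x : Set.Icc (0:ℝ) 1 | x.1 ∈ ({0, 1} : Set ℝ)} := by simp
  have hj : Joined (p (a ⟨0, hm0⟩)) (p (a ⟨1, hm1⟩)) :=
    ⟨⟨k, h ⟨0, hm0⟩, h ⟨1, hm1⟩⟩⟩
  have : (Quotient.mk (pathSetoid Y) (a ⟨0, hm0⟩)) = (Quotient.mk _ (a ⟨1, hm1⟩)) :=
    hp.1.1 (Quotient.sound hj)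
  obtain ⟨γ⟩ : Joined (a ⟨0, hm0⟩) (a ⟨1, hm1⟩) := Quotient.exact this
  refine ⟨γ.toContinuousMap, ?_⟩
  rintro ⟨x, hx⟩
  rcases hx with hx | hx
  · have : x = 0 := Subtype.ext hx
    subst this; exact γ.source
  · have : x = 1 := Subtype.ext hx
    subst this; exact γ.target

/-- the collapse map from the ball to the sphere -/
noncomputable def collapse (v : Fin n → ℝ) : WithLp 2 ((Fin n → ℝ) × ℝ) :=
  WithLp.toLp 2 ((2 * √(1 - ‖v‖ ^ 2)) • v, 1 - 2 * ‖v‖ ^ 2)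

theorem continuous_collapse : Continuous (collapse (n := n)) := by
  unfold collapse
  refine (WithLp.prod_continuous_toLp 2 _ _).comp ?_
  fun_prop

theorem norm_collapse {v : Fin n → ℝ} (hv : ‖v‖ ≤ 1) : ‖collapse v‖ = 1 := by
  have h : ‖collapse v‖ ^ 2 = 1 := by
    rw [WithLp.prod_norm_sq_eq_of_L2]
    change ‖(2 * √(1 - ‖v‖ ^ 2)) • v‖ ^ 2 + ‖1 - 2 * ‖v‖ ^ 2‖ ^ 2 = 1
    simp only [norm_smul, Real.norm_eq_abs, sq_abs, mul_pow]
    have : 0 ≤ 1 - ‖v‖ ^ 2 := by nlinarith [norm_nonneg v]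
    rw [Real.sq_sqrt this]; ring
  have h0 := norm_nonneg (collapse v)
  nlinarith

theorem collapse_bdry {v w : Fin n → ℝ} (hv : ‖v‖ = 1) (hw : ‖w‖ = 1) : collapse v = collapse w := by
  unfold collapse; simp [hv, hw]

theorem collapse_inj {v w : Fin n → ℝ} (hv : ‖v‖ ≤ 1) (hw : ‖w‖ ≤ 1)
    (h : collapse v = collapse w) : v = w ∨ (‖v‖ = 1 ∧ ‖w‖ = 1) := by
  unfold collapse at h
  have h' := (WithLp.toLp_injective 2 h)
  rw [Prod.mk.injEq] at h'
  obtain ⟨h1, h2⟩ := h'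
  have hn : ‖v‖ = ‖w‖ := by
    have : ‖v‖ ^ 2 = ‖w‖ ^ 2 := by linarith
    exact (sq_eq_sq₀ (norm_nonneg _) (norm_nonneg _)).1 this
  by_cases hv1 : ‖v‖ = 1
  · right; exact ⟨hv1, hn ▸ hv1⟩
  · left
    have hlt : ‖v‖ < 1 := lt_of_le_of_ne hv hv1
    have : 0 < 1 - ‖v‖ ^ 2 := by nlinarith [norm_nonneg v]
    rw [← hn] at h1
    exact smul_right_injective _ (by positivity : 2 * √(1 - ‖v‖ ^ 2) ≠ 0) h1

theorem collapse_surj (hn : 0 < n) (w : WithLp 2 ((Fin n → ℝ) × ℝ)) (hw : ‖w‖ = 1) :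
    ∃ v : Fin n → ℝ, ‖v‖ ≤ 1 ∧ collapse v = w := by
  have hsq := WithLp.prod_norm_sq_eq_of_L2 w
  rw [hw] at hsq
  set c := w.snd with hc
  set u := w.fst with hu
  have hww : w = WithLp.toLp 2 (u, c) := rfl
  rw [Real.norm_eq_abs c, sq_abs] at hsq
  have hc1 : c ≤ 1 := by nlinarith [sq_nonneg ‖u‖]
  have hc2 : -1 ≤ c := by nlinarith [sq_nonneg ‖u‖]
  rcases eq_or_lt_of_le hc2 with h | h
  · have : Nonempty (Fin n) := ⟨⟨0, hn⟩⟩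
    refine ⟨fun _ => 1, by simp, ?_⟩
    have hu0 : u = 0 := by
      have : ‖u‖ ^ 2 = 0 := by rw [← h] at hsq; linarith
      simpa using this
    rw [hww, hu0, ← h]
    unfold collapse
    simp; norm_num
  · have hpos : 0 < (1 + c) / 2 := by linarith
    have hs := Real.sqrt_pos.2 hpos
    have hs2 := Real.sq_sqrt hpos.le
    have hnv : ‖(2 * √((1 + c) / 2))⁻¹ • u‖ ^ 2 = (1 - c) / 2 := by
      rw [norm_smul, norm_inv, Real.norm_eq_abs, abs_of_pos (by positivity), mul_pow, inv_pow, mul_pow,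
        hs2]
      have : ‖u‖ ^ 2 = (1 - c) * (1 + c) := by nlinarith
      rw [this]
      have : (1 + c) ≠ 0 := by linarith
      field_simp
    refine ⟨(2 * √((1 + c) / 2))⁻¹ • u, ?_, ?_⟩
    · nlinarith [norm_nonneg ((2 * √((1 + c) / 2))⁻¹ • u)]
    · rw [hww]; unfold collapse
      rw [hnv]
      have : 1 - (1 - c) / 2 = (1 + c) / 2 := by ring
      rw [this, smul_smul, mul_inv_cancel₀ (by positivity), one_smul]
      congr 2; ring

theorem ext_ball (hn : 0 < n) (p : C(Y, Z)) (hp : IsWeakHomotopyEquiv p) :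
    ExtPair p {x : Metric.closedBall (0 : WithLp 2 ((Fin n → ℝ) × ℝ)) 1 | x.1 ∈
      frontier (Metric.closedBall (0 : WithLp 2 ((Fin n → ℝ) × ℝ)) 1)} := by
  rw [frontier_closedBall _ one_ne_zero]
  set W := WithLp 2 ((Fin n → ℝ) × ℝ) with hW
  intro a k h
  have : Nonempty (Fin n) := ⟨⟨0, hn⟩⟩
  have hmem : ∀ w : W, ‖w‖ = 1 → ∃ h : w ∈ Metric.closedBall (0 : W) 1,
      (⟨w, h⟩ : Metric.closedBall (0 : W) 1) ∈
      {x : Metric.closedBall (0 : W) 1 | x.1 ∈ Metric.sphere (0 : W) 1} := fun w hw =>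
    ⟨by simp [hw], by simp [hw]⟩
  -- the collapse as a map into the sphere
  let φ : C(Fin n → ℝ, {x : Metric.closedBall (0 : W) 1 | x.1 ∈ Metric.sphere (0 : W) 1}) :=
    ⟨fun v => ⟨⟨collapse (clamp v), (hmem _ (norm_collapse (norm_clamp_le v))).1⟩,
      (hmem _ (norm_collapse (norm_clamp_le v))).2⟩, by
      refine Continuous.subtype_mk (Continuous.subtype_mk ?_ _) _
      exact continuous_collapse.comp continuous_clamp⟩
  let v1 : Fin n → ℝ := fun _ => 1
  have hv1 : ‖v1‖ = 1 := by simp [v1]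
  have hφ1 : ∀ v, ‖v‖ = 1 → φ v = φ v1 := by
    intro v hv
    apply Subtype.ext; apply Subtype.ext
    change collapse (clamp v) = collapse (clamp v1)
    rw [clamp_of_le hv.le, clamp_of_le hv1.le, collapse_bdry hv hv1]
  have hseg : ∀ x : (Fin n → ℝ) × ℝ, (1 - (Set.projIcc (0:ℝ) 1 zero_le_one x.2 : ℝ)) • (φ x.1).1.1 +
      (Set.projIcc (0:ℝ) 1 zero_le_one x.2 : ℝ) • (φ v1).1.1 ∈ Metric.closedBall (0 : W) 1 := by
    intro x
    have h2 := (Set.projIcc (0:ℝ) 1 zero_le_one x.2).2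
    exact convex_closedBall (0 : W) 1 (φ x.1).1.2 (φ v1).1.2 (by linarith [h2.2]) h2.1 (by ring)
  let Ψ : C((Fin n → ℝ) × ℝ, Z) := ⟨fun x => k ⟨_, hseg x⟩, by
    refine k.continuous.comp (Continuous.subtype_mk ?_ _)
    have : Continuous fun x : (Fin n → ℝ) × ℝ => (Set.projIcc (0:ℝ) 1 zero_le_one x.2 : ℝ) :=
      continuous_subtype_val.comp (continuous_projIcc.comp continuous_snd)
    fun_prop⟩
  have q0 : ∀ v, ‖v‖ ≤ 1 → Ψ (v, 0) = p ((a.comp φ) v) := by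
    intro v _
    simp only [Ψ, ContinuousMap.coe_mk, ContinuousMap.comp_apply]
    rw [← h]; congr 1; apply Subtype.ext; simp
  have q1 : ∀ v, ‖v‖ ≤ 1 → Ψ (v, 1) = p (a (φ v1)) := by
    intro v _
    simp only [Ψ, ContinuousMap.coe_mk]
    rw [← h]; congr 1; apply Subtype.ext; simp
  have q2 : ∀ v t, ‖v‖ = 1 → Ψ (v, t) = p (a (φ v1)) := by
    intro v t hv
    simp only [Ψ, ContinuousMap.coe_mk]
    rw [← h]; congr 1; apply Subtype.ext
    simp only [hφ1 v hv]
    rw [← add_smul]; simp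
  obtain ⟨N, hN0, hN1, hNs⟩ := loop_inj p hp (a (φ v1)) (a.comp φ) (fun v hv => by
      simp only [ContinuousMap.comp_apply]; rw [hφ1 v hv]) Ψ q0 q1 q2
  -- descend along the quotient map
  let Q : C(Metric.closedBall (0 : Fin n → ℝ) 1 × I, Metric.closedBall (0 : W) 1) :=
    ⟨fun x => ⟨(1 - (x.2 : ℝ)) • (φ x.1.1).1.1, by
      have h1 : ‖(φ x.1.1).1.1‖ = 1 := mem_sphere_zero_iff_norm.1 (φ x.1.1).2
      have h2 := x.2.2.1
      have h3 := x.2.2.2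
      rw [mem_closedBall_zero_iff, norm_smul, h1, Real.norm_eq_abs, mul_one, abs_le]
      constructor <;> linarith⟩, by fun_prop⟩
  have hQn : ∀ x, ‖(Q x).1‖ = 1 - (x.2 : ℝ) := by
    intro x
    have h1 : ‖(φ x.1.1).1.1‖ = 1 := mem_sphere_zero_iff_norm.1 (φ x.1.1).2
    have h3 := x.2.2.2
    change ‖(1 - (x.2 : ℝ)) • (φ x.1.1).1.1‖ = _
    rw [norm_smul, h1, Real.norm_eq_abs, abs_of_nonneg (by linarith), mul_one]
  have hQs : Function.Surjective Q := by
    rintro ⟨w, hw⟩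
    rw [mem_closedBall_zero_iff] at hw
    by_cases hw0 : w = 0
    · refine ⟨(⟨0, by simp⟩, 1), ?_⟩
      apply Subtype.ext
      simp [Q, hw0]
    · have hwp : 0 < ‖w‖ := norm_pos_iff.2 hw0
      obtain ⟨v, hv, hvw⟩ := collapse_surj hn (‖w‖⁻¹ • w) (by
        rw [norm_smul, norm_inv, norm_norm, inv_mul_cancel₀ hwp.ne'])
      refine ⟨(⟨v, by simpa using hv⟩, ⟨1 - ‖w‖, by linarith, by linarith⟩), ?_⟩
      apply Subtype.ext
      change (1 - (1 - ‖w‖)) • collapse (clamp v) = w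
      rw [clamp_of_le hv, hvw, smul_smul, sub_sub_cancel, mul_inv_cancel₀ hwp.ne', one_smul]
  have hQq : IsQuotientMap Q := Q.continuous.isClosedMap.isQuotientMap Q.continuous hQs
  let M : C(Metric.closedBall (0 : Fin n → ℝ) 1 × I, Y) := ⟨fun x => N (x.1.1, x.2.1), by fun_prop⟩
  have hf : Function.FactorsThrough M Q := by
    intro x x' hx
    have ht : (x.2 : ℝ) = x'.2 := by
      have := hQn x; rw [hx, hQn x'] at this; linarith
    have hx1 := mem_closedBall_zero_iff.1 x.1.2
    have hx2 := mem_closedBall_zero_iff.1 x'.1.2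
    change N (x.1.1, x.2.1) = N (x'.1.1, x'.2.1)
    rw [ht]
    by_cases h1 : (x'.2 : ℝ) = 1
    · rw [h1, hN1, hN1]
    · have hval : (1 - (x.2 : ℝ)) • collapse (clamp x.1.1) = (1 - (x'.2 : ℝ)) • collapse (clamp x'.1.1) :=
        congrArg Subtype.val hx
      rw [ht, clamp_of_le hx1, clamp_of_le hx2] at hval
      rcases collapse_inj hx1 hx2 (smul_right_injective _ (sub_ne_zero.2 (Ne.symm h1)) hval) with h | h
      · rw [h]
      · rw [hNs _ _ h.1.ge, hNs _ _ h.2.ge]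
  refine ⟨hQq.lift M hf, ?_⟩
  rintro ⟨⟨w, hw⟩, hw1⟩
  have hw1' : ‖w‖ = 1 := by simpa using hw1
  obtain ⟨v, hv, hvw⟩ := collapse_surj hn w hw1'
  have hφv : φ v = ⟨⟨w, hw⟩, hw1⟩ := by
    apply Subtype.ext; apply Subtype.ext
    change collapse (clamp v) = w
    rw [clamp_of_le hv, hvw]
  have hQv : Q (⟨v, by simpa using hv⟩, 0) = ⟨w, hw⟩ := by
    apply Subtype.ext
    change (1 - (0:ℝ)) • (φ v).1.1 = w
    rw [hφv]; simp
  refine (congrArg (hQq.lift M hf) hQv.symm).trans ?_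
  have := congrArg (fun g => g (⟨v, by simpa using hv⟩, (0 : I))) (hQq.lift_comp M hf)
  refine this.trans ?_
  change N (v, 0) = _
  rw [hN0 v hv]
  simp only [ContinuousMap.comp_apply, hφv]

theorem body_ball {V : Type} [NormedAddCommGroup V] [NormedSpace ℝ V] [FiniteDimensional ℝ V] :
    Convex ℝ (Metric.closedBall (0 : V) 1) ∧ (interior (Metric.closedBall (0 : V) 1)).Nonempty ∧
    IsCompact (Metric.closedBall (0 : V) 1) := by
  have := FiniteDimensional.proper ℝ V
  refine ⟨convex_closedBall _ _, ?_, isCompact_closedBall _ _⟩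
  exact ⟨0, Metric.ball_subset_interior_closedBall (Metric.mem_ball_self one_pos)⟩

/-- extension property for the cube of positive dimension -/
theorem ext_cube (hn : 0 < n) (p : C(Y, Z)) (hp : IsWeakHomotopyEquiv p) :
    ExtPair p {x : Metric.closedBall (0 : Fin n → ℝ) 1 | x.1 ∈
      frontier (Metric.closedBall (0 : Fin n → ℝ) 1)} := by
  obtain ⟨c1, c2, c3⟩ := body_ball (V := Fin n → ℝ)
  obtain ⟨m, rfl⟩ : ∃ m, n = m + 1 := ⟨n - 1, by omega⟩
  rcases Nat.eq_zero_or_pos m with rfl | hm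
  · obtain ⟨e, he⟩ := bodyPair (V := Fin (0 + 1) → ℝ) (W := ℝ) (by simp) c1 c2 c3
      (convex_Icc (0:ℝ) 1) (by rw [interior_Icc]; exact ⟨1/2, by norm_num⟩) isCompact_Icc
    exact ExtPair.transfer e he (ext_one p hp)
  · obtain ⟨d1, d2, d3⟩ := body_ball (V := WithLp 2 ((Fin m → ℝ) × ℝ))
    obtain ⟨e, he⟩ := bodyPair (V := Fin (m + 1) → ℝ) (W := WithLp 2 ((Fin m → ℝ) × ℝ)) (by
      rw [(WithLp.linearEquiv 2 ℝ ((Fin m → ℝ) × ℝ)).finrank_eq]; simp) c1 c2 c3 d1 d2 d3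
    exact ExtPair.transfer e he (ext_ball hm p hp)
end ext


section W
variable {Y Z : Type} [TopologicalSpace Y] [TopologicalSpace Z] {n : ℕ}

theorem wlemma (p : C(Y, Z)) (hp : IsWeakHomotopyEquiv p) (a0 : C(Fin n → ℝ, Y))
    (k : C(Fin n → ℝ, Z)) (hk : ∀ v, ‖v‖ = 1 → k v = p (a0 v)) :
    ∃ (a : C(Fin n → ℝ, Y)) (Γ : C((Fin n → ℝ) × ℝ, Z)),
      (∀ v, ‖v‖ = 1 → a v = a0 v) ∧ (∀ v, ‖v‖ ≤ 1 → Γ (v, 0) = p (a v)) ∧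
      (∀ v, ‖v‖ ≤ 1 → Γ (v, 1) = k v) ∧
      (∀ v t, ‖v‖ = 1 → 0 ≤ t → t ≤ 1 → Γ (v, t) = p (a0 v)) := by
  let f : C(Fin n → ℝ, Z) := ⟨fun v => if ‖v‖ ≤ 1 / 2 then k ((2 : ℝ) • v) else
      p (a0 ((2 / max ‖v‖ (1 / 2) - 2) • v)), by
    refine Continuous.if_le (by fun_prop) ?_ (by fun_prop) (by fun_prop) ?_
    · have : Continuous fun v : Fin n → ℝ => 2 / max ‖v‖ (1 / 2) := by
        refine Continuous.div (by fun_prop) (by fun_prop) ?_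
        intro v; positivity
      fun_prop
    · intro v hv
      rw [hk _ (by rw [norm_smul, hv]; norm_num), hv]
      norm_num⟩
  have f1 : ∀ v, ‖v‖ ≤ 1 / 2 → f v = k ((2 : ℝ) • v) := fun v hv => if_pos hv
  have f2 : ∀ v, 1 / 2 ≤ ‖v‖ → f v = p (a0 ((2 / ‖v‖ - 2) • v)) := by
    intro v hv
    by_cases h : ‖v‖ ≤ 1 / 2
    · have h' : ‖v‖ = 1 / 2 := le_antisymm h hv
      rw [f1 v h, hk _ (by rw [norm_smul, h']; norm_num), h']
      norm_num
    · refine (if_neg h).trans ?_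
      rw [max_eq_left hv]
  obtain ⟨β, Θ, hβ, hΘs, hΘ0, hΘ1⟩ := loop_surj p hp (a0 0) f (by
    intro v hv; rw [f2 v (by rw [hv]; norm_num), hv]; norm_num)
  let a : C(Fin n → ℝ, Y) := ⟨fun v => if ‖v‖ ≤ 2 / 3 then β ((3 / 2 : ℝ) • v) else
      a0 ((3 - 2 / max ‖v‖ (1 / 2)) • v), by
    refine Continuous.if_le (by fun_prop) ?_ (by fun_prop) (by fun_prop) ?_
    · have : Continuous fun v : Fin n → ℝ => 2 / max ‖v‖ (1 / 2) := by
        refine Continuous.div (by fun_prop) (by fun_prop) ?_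
        intro v; positivity
      fun_prop
    · intro v hv
      rw [hβ _ (by rw [norm_smul, hv]; norm_num), hv]
      norm_num⟩
  have a1 : ∀ v, ‖v‖ ≤ 2 / 3 → a v = β ((3 / 2 : ℝ) • v) := fun v hv => if_pos hv
  have a2 : ∀ v, 2 / 3 < ‖v‖ → a v = a0 ((3 - 2 / ‖v‖) • v) := by
    intro v hv
    refine (if_neg hv.not_ge).trans ?_
    rw [max_eq_left (by linarith)]
  let μ : (Fin n → ℝ) → ℝ := fun v => min 3 (4 / max ‖v‖ (1 / 3) - 3)
  have hμ : Continuous μ := by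
    have : Continuous fun v : Fin n → ℝ => 4 / max ‖v‖ (1 / 3) := by
      refine Continuous.div (by fun_prop) (by fun_prop) ?_
      intro v; positivity
    fun_prop
  have μ1 : ∀ v, ‖v‖ ≤ 2 / 3 → μ v = 3 := by
    intro v hv
    apply min_eq_left
    have h : max ‖v‖ (1 / 3) ≤ 2 / 3 := max_le hv (by norm_num)
    have : (6 : ℝ) ≤ 4 / max ‖v‖ (1 / 3) := by
      rw [le_div_iff₀ (by positivity)]; linarith
    linarith
  have μ2 : ∀ v, 2 / 3 ≤ ‖v‖ → μ v = 4 / ‖v‖ - 3 := by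
    intro v hv
    have h0 : 0 < ‖v‖ := by linarith
    change min 3 (4 / max ‖v‖ (1 / 3) - 3) = _
    rw [max_eq_left (by linarith)]
    apply min_eq_right
    have : 4 / ‖v‖ ≤ 6 := by
      rw [div_le_iff₀ h0]; linarith
    linarith
  let B : (Fin n → ℝ) × ℝ → Z := fun x =>
    f ((((1 - max 0 (2 * x.2 - 1)) * μ x.1 + max 0 (2 * x.2 - 1)) / 2) • x.1)
  have B0 : ∀ v t, t ≤ 1 / 2 → B (v, t) = f ((μ v / 2) • v) := by
    intro v t ht
    simp only [B]
    rw [max_eq_left (by linarith)]; simp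
  have B1 : ∀ v t, 2 / 3 ≤ ‖v‖ → ‖v‖ ≤ 1 → t ≤ 1 / 2 → B (v, t) = p (a0 ((3 - 2 / ‖v‖) • v)) := by
    intro v t h1 h2 ht
    have h0 : 0 < ‖v‖ := by linarith
    rw [B0 v t ht, μ2 v h1]
    have hn : ‖((4 / ‖v‖ - 3) / 2) • v‖ = 2 - 3 * ‖v‖ / 2 := by
      rw [norm_smul, Real.norm_eq_abs, abs_of_nonneg]
      · field_simp
        norm_num
      · have : 4 ≤ 4 / ‖v‖ := by rw [le_div_iff₀ h0]; linarith
        linarith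
    rw [f2 _ (by rw [hn]; linarith), hn, smul_smul]
    congr 3
    have hd : 4 - 3 * ‖v‖ ≠ 0 := by intro h; linarith
    have e1 : 2 - 3 * ‖v‖ / 2 = (4 - 3 * ‖v‖) / 2 := by ring
    have e2 : (4 / ‖v‖ - 3) / 2 = (4 - 3 * ‖v‖) / (2 * ‖v‖) := by field_simp
    have e3 : 3 - 2 / ‖v‖ = 2 / ‖v‖ - (4 - 3 * ‖v‖) / ‖v‖ := by field_simp; ring
    rw [e1, e2, e3]
    generalize 4 - 3 * ‖v‖ = d at hd
    field_simp
  have B2 : ∀ v t, ‖v‖ = 1 → B (v, t) = k v := by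
    intro v t h
    have : μ v = 1 := by rw [μ2 v (by linarith), h]; norm_num
    simp only [B]
    rw [this, mul_one, sub_add_cancel, f1 _ (by rw [norm_smul, h]; norm_num), smul_smul]; norm_num
  have B3 : ∀ v, ‖v‖ ≤ 1 → B (v, 1) = k v := by
    intro v h
    simp only [B]
    rw [max_eq_right (by norm_num)]
    norm_num
    rw [f1 _ (by rw [norm_smul]; norm_num; linarith), smul_smul]; norm_num
  have hB : Continuous B := by fun_prop
  let Γ : C((Fin n → ℝ) × ℝ, Z) := ⟨fun x => if max (x.2 - 1 / 2) (‖x.1‖ - 2 / 3) ≤ 0 then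
      Θ ((3 / 2 : ℝ) • x.1, 2 * x.2) else B x, by
    refine Continuous.if_le (by fun_prop) hB (by fun_prop) (by fun_prop) ?_
    rintro ⟨v, t⟩ h
    simp only at h ⊢
    have ht : t ≤ 1 / 2 := by have := le_max_left (t - 1 / 2) (‖v‖ - 2 / 3); linarith
    have hv : ‖v‖ ≤ 2 / 3 := by have := le_max_right (t - 1 / 2) (‖v‖ - 2 / 3); linarith
    rw [B0 v t ht, μ1 v hv]
    have hn : ‖(3 / 2 : ℝ) • v‖ = 3 / 2 * ‖v‖ := by rw [norm_smul]; norm_num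
    rcases max_choice (t - 1 / 2) (‖v‖ - 2 / 3) with h' | h'
    · have : 2 * t = 1 := by linarith
      rw [this, hΘ1 _ (by rw [hn]; linarith)]
    · have : ‖v‖ = 2 / 3 := by linarith
      rw [hΘs _ _ (by rw [hn, this]; norm_num), f2 _ (by rw [hn, this]; norm_num), hn, this]
      norm_num⟩
  have Γ1 : ∀ v t, t ≤ 1 / 2 → ‖v‖ ≤ 2 / 3 → Γ (v, t) = Θ ((3 / 2 : ℝ) • v, 2 * t) := fun v t h1 h2 =>
    if_pos (max_le (by simp only; linarith) (by simp only; linarith))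
  have Γ2 : ∀ v t, 2 / 3 < ‖v‖ → Γ (v, t) = B (v, t) := fun v t h =>
    if_neg (by rw [not_le, lt_max_iff]; right; simp only; linarith)
  have Γ3 : ∀ v t, 1 / 2 < t → Γ (v, t) = B (v, t) := fun v t h =>
    if_neg (by rw [not_le, lt_max_iff]; left; simp only; linarith)
  refine ⟨a, Γ, ?_, ?_, ?_, ?_⟩
  · intro v h
    rw [a2 v (by rw [h]; norm_num), h]; norm_num
  · intro v h
    by_cases h' : ‖v‖ ≤ 2 / 3
    · rw [Γ1 v 0 (by norm_num) h', a1 v h', mul_zero, hΘ0]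
    · rw [not_le] at h'
      rw [Γ2 v 0 h', a2 v h', B1 v 0 h'.le h (by norm_num)]
  · intro v h
    rw [Γ3 v 1 (by norm_num), B3 v h]
  · intro v t h _ _
    rw [Γ2 v t (by rw [h]; norm_num), B2 v t h, hk v h]

set_option maxHeartbeats 1000000 in
theorem lift_cube_pos (hn : 0 < n) (p : C(Y, Z)) (hp : IsWeakHomotopyEquiv p) :
    LiftPair p {x : Metric.closedBall (0 : Fin n → ℝ) 1 | x.1 ∈
      frontier (Metric.closedBall (0 : Fin n → ℝ) 1)} := by
  have hext := ext_cube hn p hp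
  rw [frontier_closedBall _ one_ne_zero] at hext ⊢
  intro a k H h0 h1
  have cm : ∀ v : Fin n → ℝ, clamp v ∈ Metric.closedBall (0 : Fin n → ℝ) 1 := fun v =>
    mem_closedBall_zero_iff.2 (norm_clamp_le v)
  let sp : ∀ w : Fin n → ℝ, ‖w‖ = 1 →
      {x : Metric.closedBall (0 : Fin n → ℝ) 1 | x.1 ∈ Metric.sphere (0 : Fin n → ℝ) 1} := fun w hw =>
    ⟨⟨w, by simp [hw]⟩, by simp [hw]⟩
  have nd : ∀ w : Fin n → ℝ, 0 < ‖w‖ → ‖‖w‖⁻¹ • w‖ = 1 := fun w hw => by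
    rw [norm_smul, norm_inv, norm_norm, inv_mul_cancel₀ hw.ne']
  classical
  obtain ⟨E, hE1⟩ : ∃ E : (Fin n → ℝ) → Z, ∀ (w : Fin n → ℝ) (h : 0 < ‖w‖), E w =
      H (sp (‖w‖⁻¹ • w) (nd w h), Set.projIcc 0 1 zero_le_one (2 - 2 * ‖w‖)) :=
    ⟨fun w => if h : 0 < ‖w‖ then
      H (sp (‖w‖⁻¹ • w) (nd w h), Set.projIcc 0 1 zero_le_one (2 - 2 * ‖w‖)) else k ⟨_, cm 0⟩,
      fun w h => dif_pos h⟩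
  have hE : ContinuousOn E {w | 1 / 2 ≤ ‖w‖} := by
    rw [continuousOn_iff_continuous_domRestrict]
    have hpos : ∀ w : {w : Fin n → ℝ | 1 / 2 ≤ ‖w‖}, 0 < ‖w.1‖ := fun w => by
      have h : 1 / 2 ≤ ‖w.1‖ := w.2
      linarith
    refine Continuous.congr ?_ (fun w => (hE1 w.1 (hpos w)).symm)
    refine H.continuous.comp (Continuous.prodMk (Continuous.subtype_mk (Continuous.subtype_mk ?_ _) _) ?_)
    · refine Continuous.smul (Continuous.inv₀ (by fun_prop) fun w => (hpos w).ne') (by fun_prop)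
    · exact continuous_projIcc.comp (by fun_prop)
  let k' : C(Fin n → ℝ, Z) := ⟨fun w => if ‖w‖ ≤ 1 / 2 then k ⟨_, cm ((2 : ℝ) • w)⟩ else E w, by
    refine continuous_if_le (by fun_prop) (by fun_prop) ?_ hE ?_
    · refine Continuous.continuousOn ?_
      exact k.continuous.comp (Continuous.subtype_mk (by fun_prop) _)
    · intro w hw
      have hw0 : 0 < ‖w‖ := by rw [hw]; norm_num
      rw [hE1 w hw0]
      have : Set.projIcc 0 1 zero_le_one (2 - 2 * ‖w‖) = (1 : I) := by
        rw [hw]; exact Set.projIcc_of_right_le _ (by norm_num)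
      rw [this, h1]
      congr 1; apply Subtype.ext
      change clamp ((2 : ℝ) • w) = ‖w‖⁻¹ • w
      rw [clamp_of_le (by rw [norm_smul, hw]; norm_num), hw]
      norm_num⟩
  have k1 : ∀ v : Metric.closedBall (0 : Fin n → ℝ) 1, k' ((1 / 2 : ℝ) • v.1) = k v := by
    intro v
    have hv := mem_closedBall_zero_iff.1 v.2
    refine (if_pos (by rw [norm_smul]; norm_num; linarith)).trans ?_
    congr 1; apply Subtype.ext
    change clamp ((2 : ℝ) • (1 / 2 : ℝ) • v.1) = v.1
    rw [smul_smul]; norm_num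
    rw [clamp_of_le hv]
  have k2 : ∀ (s : {x : Metric.closedBall (0 : Fin n → ℝ) 1 | x.1 ∈ Metric.sphere (0 : Fin n → ℝ) 1})
      (t : I), k' ((1 - (t : ℝ) / 2) • s.1.1) = H (s, t) := by
    intro s t
    have ht0 := t.2.1
    have ht1 := t.2.2
    have hs : ‖s.1.1‖ = 1 := mem_sphere_zero_iff_norm.1 s.2
    have hnn : ‖(1 - (t : ℝ) / 2) • s.1.1‖ = 1 - (t : ℝ) / 2 := by
      rw [norm_smul, hs, mul_one, Real.norm_eq_abs, abs_of_nonneg (by linarith)]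
    by_cases h : ‖(1 - (t : ℝ) / 2) • s.1.1‖ ≤ 1 / 2
    · have ht : t = 1 := Subtype.ext (by rw [hnn] at h; change (t : ℝ) = 1; linarith)
      have := k1 s.1
      rw [ht, h1, ← this]
      norm_num
    · refine (if_neg h).trans ?_
      have hpos : 0 < ‖(1 - (t : ℝ) / 2) • s.1.1‖ := by linarith
      refine (hE1 _ hpos).trans ?_
      congr 2
      · apply Subtype.ext; apply Subtype.ext
        change ‖(1 - (t : ℝ) / 2) • s.1.1‖⁻¹ • (1 - (t : ℝ) / 2) • s.1.1 = s.1.1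
        rw [hnn, smul_smul, inv_mul_cancel₀ (by linarith), one_smul]
      · rw [hnn]
        have : 2 - 2 * (1 - (t : ℝ) / 2) = t := by ring
        rw [this, Set.projIcc_val]
  have k3 : ∀ (s : {x : Metric.closedBall (0 : Fin n → ℝ) 1 | x.1 ∈ Metric.sphere (0 : Fin n → ℝ) 1}),
      k' s.1.1 = p (a s) := by
    intro s
    have := k2 s 0
    rw [h0] at this
    simpa using this
  obtain ⟨b, hb⟩ := hext a ⟨fun w => k' w.1, by fun_prop⟩ k3
  let a0 : C(Fin n → ℝ, Y) := ⟨fun v => b ⟨_, cm v⟩,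
    b.continuous.comp (Continuous.subtype_mk (by fun_prop) _)⟩
  have ha0 : ∀ s : {x : Metric.closedBall (0 : Fin n → ℝ) 1 | x.1 ∈ Metric.sphere (0 : Fin n → ℝ) 1},
      a0 s.1.1 = a s := by
    intro s
    have hs : ‖s.1.1‖ = 1 := mem_sphere_zero_iff_norm.1 s.2
    rw [← hb s]
    refine congrArg b (Subtype.ext ?_)
    exact clamp_of_le hs.le
  obtain ⟨c, Γ, c1, c2, c3, c4⟩ := wlemma p hp a0 k' (by
    intro v hv
    have e1 := k3 (sp v hv)
    have e2 := ha0 (sp v hv)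
    change k' v = _ at e1
    change a0 v = _ at e2
    rw [e1, e2])
  refine ⟨⟨fun v => c (clamp ((3 - 2 * ‖v.1‖) • v.1)), by fun_prop⟩,
    ⟨fun x => Γ (clamp (((1 - (x.2 : ℝ)) * (3 - 2 * ‖x.1.1‖) + (x.2 : ℝ) / 2) • x.1.1),
      max (x.2 : ℝ) (2 * ‖x.1.1‖ - 1)), by fun_prop⟩, ?_, ?_, ?_, ?_⟩
  · intro s
    have hs : ‖s.1.1‖ = 1 := mem_sphere_zero_iff_norm.1 s.2
    simp only [ContinuousMap.coe_mk]
    rw [hs, ← ha0 s, ← c1 _ hs]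
    norm_num
    rw [clamp_of_le hs.le]
  · intro s t
    have hs : ‖s.1.1‖ = 1 := mem_sphere_zero_iff_norm.1 s.2
    have ht0 := t.2.1
    have ht1 := t.2.2
    simp only [ContinuousMap.coe_mk]
    rw [hs, ← k2 s t, max_eq_right (by linarith)]
    have e1 : (1 - (t : ℝ)) * (3 - 2 * 1) + (t : ℝ) / 2 = 1 - (t : ℝ) / 2 := by ring
    have e2 : (2 * 1 - 1 : ℝ) = 1 := by norm_num
    have hnn : ‖(1 - (t : ℝ) / 2) • s.1.1‖ ≤ 1 := by
      rw [norm_smul, hs, mul_one, Real.norm_eq_abs, abs_of_nonneg (by linarith)]; linarith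
    rw [e1, e2, clamp_of_le hnn, c3 _ hnn]
  · intro v
    have hv := mem_closedBall_zero_iff.1 v.2
    have hv0 := norm_nonneg v.1
    simp only [ContinuousMap.coe_mk, Set.Icc.coe_zero, sub_zero, one_mul, zero_div, add_zero]
    by_cases h : ‖v.1‖ ≤ 1 / 2
    · rw [max_eq_left (by linarith), c2 _ (norm_clamp_le _)]
    · rw [not_le] at h
      have hh : 1 ≤ ‖(3 - 2 * ‖v.1‖) • v.1‖ := by
        rw [norm_smul, Real.norm_eq_abs, abs_of_nonneg (by linarith)]; nlinarith
      have := norm_clamp_of_ge hh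
      rw [c4 _ _ this (le_max_left _ _) (max_le (by norm_num) (by linarith)), c1 _ this]
  · intro v
    have hv := mem_closedBall_zero_iff.1 v.2
    simp only [ContinuousMap.coe_mk, Set.Icc.coe_one, sub_self, zero_mul, zero_add]
    have hnn : ‖(1 / 2 : ℝ) • v.1‖ ≤ 1 := by
      rw [norm_smul]; norm_num; linarith
    rw [max_eq_left (by linarith), clamp_of_le hnn, c3 _ hnn, k1]

theorem lift_subsingleton (p : C(Y, Z)) (hp : IsWeakHomotopyEquiv p) {B : Type} [TopologicalSpace B]
    [Subsingleton B] (b0 : B) (S : Set B) (hS : S = ∅) : LiftPair p S := by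
  subst hS
  intro a k H h0 h1
  obtain ⟨q, hq⟩ := hp.1.2 (Quotient.mk _ (k b0))
  induction q using Quotient.inductionOn with | _ y => ?_
  obtain ⟨γ⟩ : Joined (p y) (k b0) := Quotient.exact hq
  refine ⟨ContinuousMap.const _ y, ⟨fun x => γ x.2, by fun_prop⟩, ?_, ?_, ?_, ?_⟩
  · rintro ⟨_, h⟩; exact h.elim
  · rintro ⟨_, h⟩; exact h.elim
  · intro b; simp
  · intro b; rw [Subsingleton.elim b b0]; simp

theorem lift_cube (p : C(Y, Z)) (hp : IsWeakHomotopyEquiv p) (n : ℕ) :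
    LiftPair p {x : Metric.closedBall (0 : Fin n → ℝ) 1 | x.1 ∈
      frontier (Metric.closedBall (0 : Fin n → ℝ) 1)} := by
  rcases Nat.eq_zero_or_pos n with rfl | h
  · refine lift_subsingleton p hp ⟨0, by simp⟩ _ ?_
    rw [Set.eq_empty_iff_forall_notMem]
    rintro ⟨x, _⟩ hx
    rw [Set.mem_ofPred_eq, frontier_closedBall _ one_ne_zero, mem_sphere_zero_iff_norm] at hx
    have h0 : ‖x‖ = 0 := by rw [Subsingleton.elim x 0, norm_zero]
    linarith
  · exact lift_cube_pos h p hp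

theorem lift_body (p : C(Y, Z)) (hp : IsWeakHomotopyEquiv p) {V : Type} [NormedAddCommGroup V]
    [NormedSpace ℝ V] [FiniteDimensional ℝ V] {C : Set V} (h1 : Convex ℝ C)
    (h2 : (interior C).Nonempty) (h3 : IsCompact C) : LiftPair p {x : C | x.1 ∈ frontier C} := by
  obtain ⟨d1, d2, d3⟩ := body_ball (V := Fin (Module.finrank ℝ V) → ℝ)
  obtain ⟨e, he⟩ := bodyPair (W := Fin (Module.finrank ℝ V) → ℝ) (by simp) h1 h2 h3 d1 d2 d3
  exact LiftPair.transfer e he (lift_cube p hp _)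

theorem lift_disk (p : C(Y, Z)) (hp : IsWeakHomotopyEquiv p) (n : ℕ) :
    LiftPair p {x : closedDisk n | x.1 ∈ Metric.sphere (0 : EuclideanSpace ℝ (Fin n)) 1} := by
  obtain ⟨d1, d2, d3⟩ := body_ball (V := EuclideanSpace ℝ (Fin n))
  have := lift_body p hp d1 d2 d3
  rwa [frontier_closedBall _ one_ne_zero] at this

end W

section W
variable {Y Z : Type} [TopologicalSpace Y] [TopologicalSpace Z] {n : ℕ}

theorem lift_body_prod (p : C(Y, Z)) (hp : IsWeakHomotopyEquiv p) {V : Type} [NormedAddCommGroup V]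
    [NormedSpace ℝ V] [FiniteDimensional ℝ V] {C : Set V} (d1 : Convex ℝ C)
    (d2 : (interior C).Nonempty) (d3 : IsCompact C) :
    LiftPair p {x : C × I | x.1.1 ∈ frontier C ∨ x.2 = 0 ∨ x.2 = 1} := by
  have d4 : Convex ℝ (C ×ˢ Set.Icc (0:ℝ) 1) := d1.prod (convex_Icc (0:ℝ) 1)
  have d5 : (interior (C ×ˢ Set.Icc (0:ℝ) 1)).Nonempty := by
    rw [interior_prod_eq, interior_Icc]; exact d2.prod ⟨1/2, by norm_num⟩
  have := lift_body p hp d4 d5 (d3.prod isCompact_Icc)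
  let e : (C × I) ≃ₜ (C ×ˢ Set.Icc (0:ℝ) 1 : Set _) :=
    { toFun := fun x => ⟨(x.1.1, x.2.1), ⟨x.1.2, x.2.2⟩⟩
      invFun := fun x => (⟨x.1.1, x.2.1⟩, ⟨x.1.2, x.2.2⟩)
      left_inv := fun x => rfl
      right_inv := fun x => rfl
      continuous_toFun := by fun_prop
      continuous_invFun := by fun_prop }
  refine LiftPair.transfer e ?_ this
  rintro ⟨x, t⟩
  have hx := x.2
  have ht := t.2
  have e0 : t = 0 ↔ t.1 = 0 := Subtype.ext_iff
  have e1 : t = 1 ↔ t.1 = 1 := Subtype.ext_iff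
  rw [Set.mem_ofPred_eq, Set.mem_ofPred_eq, e0, e1]
  change (x.1, t.1) ∈ _ ↔ _
  rw [frontier_prod_eq, frontier_Icc zero_le_one, isClosed_Icc.closure_eq, d3.isClosed.closure_eq]
  change (x.1 ∈ _ ∧ (t.1 = 0 ∨ t.1 = 1) ∨ x.1 ∈ _ ∧ t.1 ∈ _) ↔ _
  tauto

theorem lift_disk_prod (p : C(Y, Z)) (hp : IsWeakHomotopyEquiv p) (n : ℕ) :
    LiftPair p {x : closedDisk n × I | x.1.1 ∈ Metric.sphere (0 : EuclideanSpace ℝ (Fin n)) 1 ∨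
      x.2 = 0 ∨ x.2 = 1} := by
  obtain ⟨d1, d2, d3⟩ := body_ball (V := EuclideanSpace ℝ (Fin n))
  have := lift_body_prod p hp d1 d2 d3
  rwa [frontier_closedBall _ one_ne_zero] at this
end W


theorem hom_congrP {X Y : Flow} {f g : FlowHom X Y} (h : f = g) (x : X.Path) :
    f.toFunP x = g.toFunP x := by rw [h]

theorem hom_congr0 {X Y : Flow} {f g : FlowHom X Y} (h : f = g) (x : X.State) :
    f.toFun0 x = g.toFun0 x := by rw [h]

/-- cellwise lifting of morphisms out of S-cofibrant flows -/
theorem lift_cofibrant {A Q B : Flow} (q : FlowHom Q B) (hq0 : Function.Bijective q.toFun0)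
    (hq : ∀ n (a : C(diskBoundary n, Q.Path)) (k : C(closedDisk n, B.Path)),
      (∀ x, q.toFunP (a x) = k (diskBoundaryInclusion n x)) →
      ∃ d : C(closedDisk n, Q.Path), (∀ x, d (diskBoundaryInclusion n x) = a x) ∧
        ∀ v, q.toFunP (d v) = k v)
    (hA : SCofibrant A) (F : FlowHom A B) : ∃ G : FlowHom A Q, q.comp G = F := by
  obtain ⟨c⟩ := hA
  have step : ∀ n (g : FlowHom (c.sk n) Q), q.comp g = F.comp (c.incl n) →
      ∃ g' : FlowHom (c.sk (n + 1)) Q, q.comp g' = F.comp (c.incl (n + 1)) ∧ g'.comp (c.ι n) = g := by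
    intro n g hg
    have hcell : ∀ i : c.cells n, ∃ k : FlowHom (Glob (closedDisk n)) Q,
        k.comp (globBoundaryInclusion n) = g.comp (c.attachMap n i) ∧
        q.comp k = (F.comp (c.incl (n + 1))).comp (c.cellMap n i) := by
      intro i
      have hcomm : q.comp (g.comp (c.attachMap n i)) =
          ((F.comp (c.incl (n + 1))).comp (c.cellMap n i)).comp (globBoundaryInclusion n) := by
        rw [← FlowHom.comp_assoc, hg, ← c.incl_comm n, FlowHom.comp_assoc, FlowHom.comp_assoc,
          FlowHom.comp_assoc, FlowHom.comp_assoc, c.attach_comm]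
      obtain ⟨d, hd1, hd2⟩ := hq n (g.comp (c.attachMap n i)).pathMap
        ((F.comp (c.incl (n + 1))).comp (c.cellMap n i)).pathMap (fun x => hom_congrP hcomm x)
      obtain ⟨inv, hinv⟩ := hq0.2.hasRightInverse
      refine ⟨⟨fun e => inv (((F.comp (c.incl (n + 1))).comp (c.cellMap n i)).toFun0 e), d,
        d.continuous, ?_, ?_, ?_⟩, ?_, ?_⟩
      · intro v
        apply hq0.1
        rw [hinv, ← q.s_map]
        exact (congrArg B.s (hd2 v)).trans (((F.comp (c.incl (n + 1))).comp (c.cellMap n i)).s_map v)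
      · intro v
        apply hq0.1
        rw [hinv, ← q.t_map]
        exact (congrArg B.t (hd2 v)).trans (((F.comp (c.incl (n + 1))).comp (c.cellMap n i)).t_map v)
      · intro x y h
        exact absurd (show (1 : Fin 2) = 0 from h) (by decide)
      · refine FlowHom.ext ?_ ?_
        · funext e
          apply hq0.1
          refine (hinv _).trans ?_
          exact (hom_congr0 hcomm e).symm
        · funext x; exact hd1 x
      · refine FlowHom.ext ?_ ?_
        · funext e
          exact hinv _
        · funext x; exact hd2 x
    choose k hk1 hk2 using hcell
    obtain ⟨g', ⟨hg1, hg2⟩, -⟩ := c.attach_isPushout n Q g k hk1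
    refine ⟨g', ?_, hg1⟩
    obtain ⟨u, -, hu⟩ := c.attach_isPushout n B (q.comp g) (fun i => q.comp (k i)) (fun i => by
      rw [FlowHom.comp_assoc, hk1, FlowHom.comp_assoc])
    rw [hu (q.comp g') ⟨by rw [FlowHom.comp_assoc, hg1], fun i => by rw [FlowHom.comp_assoc, hg2]⟩,
      hu (F.comp (c.incl (n + 1))) ⟨by rw [FlowHom.comp_assoc, c.incl_comm, hg], fun i => (hk2 i).symm⟩]
  have base : ∃ g : FlowHom (c.sk 0) Q, q.comp g = F.comp (c.incl 0) := by
    obtain ⟨inv, hinv⟩ := hq0.2.hasRightInverse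
    have := c.isEmpty_path_sk_zero
    refine ⟨⟨fun e => inv ((F.comp (c.incl 0)).toFun0 e), fun x => isEmptyElim x,
      continuous_of_isEmpty _, fun x => isEmptyElim x, fun x => isEmptyElim x,
      fun x => isEmptyElim x⟩, ?_⟩
    refine FlowHom.ext ?_ ?_
    · funext e; exact hinv _
    · funext x; exact isEmptyElim x
  obtain ⟨g0, hg0⟩ := base
  choose st hst1 hst2 using step
  let G : ∀ n, {g : FlowHom (c.sk n) Q // q.comp g = F.comp (c.incl n)} := fun n =>
    Nat.rec ⟨g0, hg0⟩ (fun n g => ⟨st n g.1 g.2, hst1 n g.1 g.2⟩) n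
  obtain ⟨h, hh, -⟩ := c.isColimit Q (fun n => (G n).1) (fun n => hst2 n (G n).1 (G n).2)
  refine ⟨h, ?_⟩
  obtain ⟨u, -, hu⟩ := c.isColimit B (fun n => F.comp (c.incl n)) (fun n => by
    rw [FlowHom.comp_assoc, c.incl_comm])
  rw [hu F (fun n => rfl), hu (q.comp h) (fun n => by rw [FlowHom.comp_assoc, hh]; exact (G n).2)]

theorem Flow.continuous_s (X : Flow) : Continuous X.s :=
  continuous_discrete_rng.2 X.isOpen_preimage_s

theorem Flow.continuous_t (X : Flow) : Continuous X.t :=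
  continuous_discrete_rng.2 X.isOpen_preimage_t

theorem s_const (X : Flow) {T : Type} [TopologicalSpace T] [PreconnectedSpace T] (f : C(T, X.Path))
    (x y : T) : X.s (f x) = X.s (f y) :=
  PreconnectedSpace.constant inferInstance (X.continuous_s.comp f.continuous)

theorem t_const (X : Flow) {T : Type} [TopologicalSpace T] [PreconnectedSpace T] (f : C(T, X.Path))
    (x y : T) : X.t (f x) = X.t (f y) :=
  PreconnectedSpace.constant inferInstance (X.continuous_t.comp f.continuous)

section Fl
variable {Y Z : Flow} (p : FlowHom Y Z) {S T : Type} [TopologicalSpace S] [TopologicalSpace T]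
  [LocallyCompactSpace S] [LocallyCompactSpace T] (j : C(S, T))

/-- condition on the paths of the mapping flow -/
structure FlCond (x : (Y.State × Y.State) × C(S, Y.Path) × C(T, Z.Path)) : Prop where
  s1 : ∀ u, Y.s (x.2.1 u) = x.1.1
  t1 : ∀ u, Y.t (x.2.1 u) = x.1.2
  s2 : ∀ u, Z.s (x.2.2 u) = p.toFun0 x.1.1
  t2 : ∀ u, Z.t (x.2.2 u) = p.toFun0 x.1.2
  cj : ∀ u, x.2.2 (j u) = p.toFunP (x.2.1 u)

/-- pointwise composition -/
def pcomp (X : Flow) {R : Type} [TopologicalSpace R] (a b : C(R, X.Path))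
    (h : ∀ u, X.t (a u) = X.s (b u)) : C(R, X.Path) :=
  ⟨fun u => X.comp (a u) (b u) (h u), X.continuous_comp.comp
    (Continuous.subtype_mk (by fun_prop : Continuous fun u => (a u, b u)) h)⟩

theorem continuous_pcomp (X : Flow) {R E : Type} [TopologicalSpace R] [LocallyCompactSpace R]
    [TopologicalSpace E] (a b : E → C(R, X.Path)) (ha : Continuous a) (hb : Continuous b)
    (h : ∀ e u, X.t (a e u) = X.s (b e u)) :
    Continuous fun e => pcomp X (a e) (b e) (h e) := by
  apply ContinuousMap.continuous_of_continuous_uncurry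
  refine X.continuous_comp.comp (Continuous.subtype_mk
    (?_ : Continuous fun x : E × R => (a x.1 x.2, b x.1 x.2)) fun x => h x.1 x.2)
  fun_prop

/-- the mapping flow -/
def Fl : Flow where
  State := Y.State
  Path := {x : (Y.State × Y.State) × C(S, Y.Path) × C(T, Z.Path) // FlCond p j x}
  s x := x.1.1.1
  t x := x.1.1.2
  isOpen_preimage_s a := (isOpen_discrete {a}).preimage (by fun_prop)
  isOpen_preimage_t a := (isOpen_discrete {a}).preimage (by fun_prop)
  comp x y h := ⟨((x.1.1.1, y.1.1.2),
      pcomp Y x.1.2.1 y.1.2.1 (fun u => (x.2.t1 u).trans (h.trans (y.2.s1 u).symm)),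
      pcomp Z x.1.2.2 y.1.2.2 (fun u => (x.2.t2 u).trans ((congrArg p.toFun0 h).trans (y.2.s2 u).symm))),
    { s1 := fun u => (Y.s_comp _ _ _).trans (x.2.s1 u)
      t1 := fun u => (Y.t_comp _ _ _).trans (y.2.t1 u)
      s2 := fun u => (Z.s_comp _ _ _).trans (x.2.s2 u)
      t2 := fun u => (Z.t_comp _ _ _).trans (y.2.t2 u)
      cj := fun u => by
        have h1 := x.2.cj u
        have h2 := y.2.cj u
        change Z.comp (x.1.2.2 (j u)) (y.1.2.2 (j u)) _ = p.toFunP (Y.comp (x.1.2.1 u) (y.1.2.1 u) _)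
        rw [p.comp_map _ _ _ (by
          rw [p.t_map, p.s_map, x.2.t1, y.2.s1, h])]
        congr 1 }⟩
  continuous_comp := by
    refine Continuous.subtype_mk (Continuous.prodMk ?_ (Continuous.prodMk ?_ ?_)) _
    · fun_prop
    · exact continuous_pcomp Y _ _ (by fun_prop) (by fun_prop) _
    · exact continuous_pcomp Z _ _ (by fun_prop) (by fun_prop) _
  s_comp x y h := rfl
  t_comp x y h := rfl
  comp_assoc x y z h1 h2 h3 h4 := by
    apply Subtype.ext
    refine Prod.ext rfl (Prod.ext ?_ ?_)
    · ext u; exact Y.comp_assoc _ _ _ _ _ _ _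
    · ext u; exact Z.comp_assoc _ _ _ _ _ _ _

end Fl


section Fl
variable {Y Z : Flow} (p : FlowHom Y Z) {S T : Type} [TopologicalSpace S] [TopologicalSpace T]
  [LocallyCompactSpace S] [LocallyCompactSpace T] (j : C(S, T))
  {S' T' : Type} [TopologicalSpace S'] [TopologicalSpace T']
  [LocallyCompactSpace S'] [LocallyCompactSpace T'] (j' : C(S', T'))

/-- evaluation into `Y` -/
def Fl.evY (u : S) : FlowHom (Fl p j) Y where
  toFun0 := fun e => e
  toFunP := fun x => x.1.2.1 u
  continuous_toFunP := by
    have h : Continuous fun x : {x : (Y.State × Y.State) × C(S, Y.Path) × C(T, Z.Path) // FlCond p j x} =>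
      x.1.2.1 u := by fun_prop
    exact h
  s_map x := x.2.s1 u
  t_map x := x.2.t1 u
  comp_map _ _ _ _ := rfl

/-- evaluation into `Z` -/
def Fl.evZ (u : T) : FlowHom (Fl p j) Z where
  toFun0 := p.toFun0
  toFunP := fun x => x.1.2.2 u
  continuous_toFunP := by
    have h : Continuous fun x : {x : (Y.State × Y.State) × C(S, Y.Path) × C(T, Z.Path) // FlCond p j x} =>
      x.1.2.2 u := by fun_prop
    exact h
  s_map x := x.2.s2 u
  t_map x := x.2.t2 u
  comp_map _ _ _ _ := rfl

theorem Fl.continuous_evY : Continuous fun x : (Fl p j).Path × S => (Fl.evY p j x.2).toFunP x.1 := by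
  have h : Continuous fun x : {x : (Y.State × Y.State) × C(S, Y.Path) × C(T, Z.Path) // FlCond p j x} × S =>
      x.1.1.2.1 x.2 := by fun_prop
  exact h

theorem Fl.continuous_evZ : Continuous fun x : (Fl p j).Path × T => (Fl.evZ p j x.2).toFunP x.1 := by
  have h : Continuous fun x : {x : (Y.State × Y.State) × C(S, Y.Path) × C(T, Z.Path) // FlCond p j x} × T =>
      x.1.1.2.2 x.2 := by fun_prop
  exact h

/-- two morphisms into the mapping flow agree if all evaluations do -/
theorem Fl.path_ext {x y : (Fl p j).Path} (hs : (Fl p j).s x = (Fl p j).s y)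
    (ht : (Fl p j).t x = (Fl p j).t y) (hY : ∀ u, (Fl.evY p j u).toFunP x = (Fl.evY p j u).toFunP y)
    (hZ : ∀ u, (Fl.evZ p j u).toFunP x = (Fl.evZ p j u).toFunP y) : x = y := by
  apply Subtype.ext
  refine Prod.ext (Prod.ext hs ht) (Prod.ext ?_ ?_)
  · ext u; exact hY u
  · ext u; exact hZ u

/-- restriction -/
def Fl.res (i : C(S', S)) (k : C(T', T)) (hj : ∀ u, k (j' u) = j (i u)) :
    FlowHom (Fl p j) (Fl p j') where
  toFun0 := fun e => e
  toFunP := fun x => ⟨(x.1.1, x.1.2.1.comp i, x.1.2.2.comp k),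
    { s1 := fun u => x.2.s1 _
      t1 := fun u => x.2.t1 _
      s2 := fun u => x.2.s2 _
      t2 := fun u => x.2.t2 _
      cj := fun u => by
        have := x.2.cj (i u)
        rw [← hj] at this
        exact this }⟩
  continuous_toFunP := by
    have h : Continuous fun x : {x : (Y.State × Y.State) × C(S, Y.Path) × C(T, Z.Path) // FlCond p j x} =>
      (x.1.1, x.1.2.1.comp i, x.1.2.2.comp k) := by fun_prop
    exact h.subtype_mk _
  s_map x := rfl
  t_map x := rfl
  comp_map _ _ _ _ := rfl

/-- build a morphism to the mapping flow from families -/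
def Fl.mkHom {A : Flow} (G0 : A.State → Y.State) (φ : S → FlowHom A Y) (ψ : T → FlowHom A Z)
    (hφ0 : ∀ u e, (φ u).toFun0 e = G0 e) (hψ0 : ∀ u e, (ψ u).toFun0 e = p.toFun0 (G0 e))
    (hφ : Continuous fun x : A.Path × S => (φ x.2).toFunP x.1)
    (hψ : Continuous fun x : A.Path × T => (ψ x.2).toFunP x.1)
    (hj : ∀ u x, (ψ (j u)).toFunP x = p.toFunP ((φ u).toFunP x)) : FlowHom A (Fl p j) where
  toFun0 := G0
  toFunP := fun x => ⟨((G0 (A.s x), G0 (A.t x)), ⟨fun u => (φ u).toFunP x, hφ.comp (Continuous.prodMk_right x)⟩,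
      ⟨fun u => (ψ u).toFunP x, hψ.comp (Continuous.prodMk_right x)⟩),
    { s1 := fun u => ((φ u).s_map x).trans (hφ0 _ _)
      t1 := fun u => ((φ u).t_map x).trans (hφ0 _ _)
      s2 := fun u => ((ψ u).s_map x).trans (hψ0 _ _)
      t2 := fun u => ((ψ u).t_map x).trans (hψ0 _ _)
      cj := fun u => hj u x }⟩
  continuous_toFunP := by
    refine Continuous.subtype_mk (Continuous.prodMk ?_ (Continuous.prodMk ?_ ?_)) _
    · exact ((continuous_of_discreteTopology (f := G0)).comp A.continuous_s).prodMk
        ((continuous_of_discreteTopology (f := G0)).comp A.continuous_t)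
    · exact ContinuousMap.continuous_of_continuous_uncurry _ hφ
    · exact ContinuousMap.continuous_of_continuous_uncurry _ hψ
  s_map x := rfl
  t_map x := rfl
  comp_map x y h h' := by
    refine Fl.path_ext p j ?_ ?_ ?_ ?_
    · exact congrArg G0 (A.s_comp x y h)
    · exact congrArg G0 (A.t_comp x y h)
    · intro u
      exact (φ u).comp_map x y h _
    · intro u
      exact (ψ u).comp_map x y h _

/-- the lifting problem to be solved cellwise -/
def CellLift (i : C(S', S)) (k : C(T', T)) : Prop :=
  ∀ (n : ℕ) (αa : C(diskBoundary n × S, Y.Path)) (βa : C(diskBoundary n × T, Z.Path))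
    (αk : C(closedDisk n × S', Y.Path)) (βk : C(closedDisk n × T', Z.Path)),
    (∀ v x, βa (v, j x) = p.toFunP (αa (v, x))) → (∀ v x, βk (v, j' x) = p.toFunP (αk (v, x))) →
    (∀ v x, αa (v, i x) = αk (diskBoundaryInclusion n v, x)) →
    (∀ v x, βa (v, k x) = βk (diskBoundaryInclusion n v, x)) →
    ∃ (α : C(closedDisk n × S, Y.Path)) (β : C(closedDisk n × T, Z.Path)),
      (∀ v x, β (v, j x) = p.toFunP (α (v, x))) ∧
      (∀ v x, α (diskBoundaryInclusion n v, x) = αa (v, x)) ∧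
      (∀ v x, β (diskBoundaryInclusion n v, x) = βa (v, x)) ∧
      (∀ v x, α (v, i x) = αk (v, x)) ∧ (∀ v x, β (v, k x) = βk (v, x))

theorem lift_Fl [PreconnectedSpace T] [Nonempty T'] (hp : Function.Injective p.toFun0)
    (i : C(S', S)) (k : C(T', T)) (hj : ∀ u, k (j' u) = j (i u)) (hl : CellLift p j j' i k)
    {A : Flow} (hA : SCofibrant A) (F : FlowHom A (Fl p j')) :
    ∃ G : FlowHom A (Fl p j), (Fl.res p j j' i k hj).comp G = F := by
  refine lift_cofibrant (Fl.res p j j' i k hj) Function.bijective_id ?_ hA F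
  intro n a b hab
  obtain ⟨α, β, h1, h2, h3, h4, h5⟩ := hl n
    ⟨fun x => (Fl.evY p j x.2).toFunP (a x.1), (Fl.continuous_evY p j).comp
      (by fun_prop : Continuous fun x : diskBoundary n × S => (a x.1, x.2))⟩
    ⟨fun x => (Fl.evZ p j x.2).toFunP (a x.1), (Fl.continuous_evZ p j).comp
      (by fun_prop : Continuous fun x : diskBoundary n × T => (a x.1, x.2))⟩
    ⟨fun x => (Fl.evY p j' x.2).toFunP (b x.1), (Fl.continuous_evY p j').comp
      (by fun_prop : Continuous fun x : closedDisk n × S' => (b x.1, x.2))⟩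
    ⟨fun x => (Fl.evZ p j' x.2).toFunP (b x.1), (Fl.continuous_evZ p j').comp
      (by fun_prop : Continuous fun x : closedDisk n × T' => (b x.1, x.2))⟩
    (fun v x => (a v).2.cj x) (fun v x => (b v).2.cj x)
    (fun v x => congrArg (Fl.evY p j' x).toFunP (hab v))
    (fun v x => congrArg (Fl.evZ p j' x).toFunP (hab v))
  obtain ⟨t0⟩ := ‹Nonempty T'›
  have hs : ∀ v x, Z.s (β (v, x)) = p.toFun0 ((Fl p j').s (b v)) := fun v x => by
    refine (s_const Z ⟨fun x => β (v, x), by fun_prop⟩ x (k t0)).trans ?_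
    refine (congrArg Z.s (h5 v t0)).trans ?_
    exact (Fl.evZ p j' t0).s_map (b v)
  have ht : ∀ v x, Z.t (β (v, x)) = p.toFun0 ((Fl p j').t (b v)) := fun v x => by
    refine (t_const Z ⟨fun x => β (v, x), by fun_prop⟩ x (k t0)).trans ?_
    refine (congrArg Z.t (h5 v t0)).trans ?_
    exact (Fl.evZ p j' t0).t_map (b v)
  let d : closedDisk n → (Fl p j).Path := fun v =>
    ⟨(((Fl p j').s (b v), (Fl p j').t (b v)), ⟨fun x => α (v, x), by fun_prop⟩,
      ⟨fun x => β (v, x), by fun_prop⟩),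
    { s1 := fun u => hp (by rw [← hs v (j u), h1, p.s_map]; rfl)
      t1 := fun u => hp (by rw [← ht v (j u), h1, p.t_map]; rfl)
      s2 := fun u => hs v u
      t2 := fun u => ht v u
      cj := fun u => h1 v u }⟩
  have hd : Continuous d := by
    refine Continuous.subtype_mk (Continuous.prodMk ?_ (Continuous.prodMk ?_ ?_)) _
    · exact ((Fl p j').continuous_s.comp b.continuous).prodMk ((Fl p j').continuous_t.comp b.continuous)
    · exact ContinuousMap.continuous_of_continuous_uncurry _ α.continuous
    · exact ContinuousMap.continuous_of_continuous_uncurry _ β.continuous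
  refine ⟨⟨d, hd⟩, ?_, ?_⟩
  · intro v
    refine Fl.path_ext p j ?_ ?_ ?_ ?_
    · exact (congrArg (Fl p j').s (hab v)).symm
    · exact (congrArg (Fl p j').t (hab v)).symm
    · intro u; exact h2 v u
    · intro u; exact h3 v u
  · intro v
    refine Fl.path_ext p j' rfl rfl ?_ ?_
    · intro u; exact h4 v u
    · intro u; exact h5 v u
end Fl


theorem SHomotopy.trans {X Y : Flow} {f g h : FlowHom X Y} (h1 : SHomotopy f g) (h2 : SHomotopy g h) :
    SHomotopy f h := by
  obtain ⟨F, F0, F1, Fc, Fs⟩ := h1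
  obtain ⟨K, K0, K1, Kc, Ks⟩ := h2
  let l : I → I := fun u => Set.projIcc 0 1 zero_le_one (2 * (u : ℝ))
  let r : I → I := fun u => Set.projIcc 0 1 zero_le_one (2 * (u : ℝ) - 1)
  have hl : Continuous l := continuous_projIcc.comp (by fun_prop)
  have hr : Continuous r := continuous_projIcc.comp (by fun_prop)
  have key : ∀ u : I, (u : ℝ) = 1 / 2 → F (l u) = K (r u) := by
    intro u hu
    have e1 : l u = 1 := Set.projIcc_of_right_le _ (by rw [hu]; norm_num)
    have e2 : r u = 0 := Set.projIcc_of_le_left _ (by rw [hu]; norm_num)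
    rw [e1, e2, F1, K0]
  refine ⟨fun u => if (u : ℝ) ≤ 1 / 2 then F (l u) else K (r u), ?_, ?_, ?_, ?_⟩
  · have e : l 0 = 0 := Set.projIcc_of_le_left _ (by simp)
    simp only [Set.Icc.coe_zero]
    rw [if_pos (by norm_num), e, F0]
  · have e : r 1 = 1 := Set.projIcc_of_right_le _ (by norm_num)
    simp only [Set.Icc.coe_one]
    rw [if_neg (by norm_num), e, K1]
  · have : (fun q : X.Path × I => (if (q.2 : ℝ) ≤ 1 / 2 then F (l q.2) else K (r q.2)).toFunP q.1) =
        fun q => if (q.2 : ℝ) ≤ 1 / 2 then (F (l q.2)).toFunP q.1 else (K (r q.2)).toFunP q.1 := by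
      funext q; split <;> rfl
    rw [this]
    refine Continuous.if_le ?_ ?_ (by fun_prop) (by fun_prop) ?_
    · exact Fc.comp (by fun_prop : Continuous fun q : X.Path × I => (q.1, l q.2))
    · exact Kc.comp (by fun_prop : Continuous fun q : X.Path × I => (q.1, r q.2))
    · intro q hq; rw [key _ hq]
  · have : (fun q : X.State × I => (if (q.2 : ℝ) ≤ 1 / 2 then F (l q.2) else K (r q.2)).toFun0 q.1) =
        fun q => if (q.2 : ℝ) ≤ 1 / 2 then (F (l q.2)).toFun0 q.1 else (K (r q.2)).toFun0 q.1 := by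
      funext q; split <;> rfl
    rw [this]
    refine Continuous.if_le ?_ ?_ (by fun_prop) (by fun_prop) ?_
    · exact Fs.comp (by fun_prop : Continuous fun q : X.State × I => (q.1, l q.2))
    · exact Ks.comp (by fun_prop : Continuous fun q : X.State × I => (q.1, r q.2))
    · intro q hq; rw [key _ hq]

theorem SHomotopy.precomp {W X Y : Flow} {f g : FlowHom X Y} (h : SHomotopy f g) (e : FlowHom W X) :
    SHomotopy (f.comp e) (g.comp e) := by
  obtain ⟨F, F0, F1, Fc, Fs⟩ := h
  refine ⟨fun u => (F u).comp e, congrArg (fun k => FlowHom.comp k e) F0, congrArg (fun k => FlowHom.comp k e) F1, ?_, ?_⟩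
  · exact Fc.comp ((e.continuous_toFunP.comp continuous_fst).prodMk continuous_snd)
  · exact Fs.comp (((continuous_of_discreteTopology (f := e.toFun0)).comp continuous_fst).prodMk
      continuous_snd)

section exist
variable {Y Z : Flow} (p : FlowHom Y Z)

theorem cellLift_exist (hp : IsWeakHomotopyEquiv p.pathMap) :
    CellLift p (ContinuousMap.const PUnit.{1} (0 : I)) (ContinuousMap.const Empty PUnit.unit.{1})
      ⟨fun e : Empty => (e.elim : PUnit.{1}), continuous_of_isEmpty _⟩
      (ContinuousMap.const PUnit.{1} (1 : I)) := by
  intro n αa βa αk βk h1 h2 h3 h4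
  obtain ⟨a', H', c1, c2, c3, c4⟩ := lift_disk p.pathMap hp n
    ⟨fun x => αa (⟨x.1.1, x.2⟩, PUnit.unit), by fun_prop⟩
    ⟨fun v => βk (v, PUnit.unit), by fun_prop⟩
    ⟨fun x => βa (⟨x.1.1.1, x.1.2⟩, x.2), by fun_prop⟩
    (fun s => h1 _ _) (fun s => h4 ⟨s.1.1, s.2⟩ PUnit.unit)
  refine ⟨⟨fun x => a' x.1, by fun_prop⟩, H', ?_, ?_, ?_, ?_, ?_⟩
  · intro v _; exact c3 v
  · intro v _; exact c1 ⟨diskBoundaryInclusion n v, v.2⟩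
  · intro v x; exact c2 ⟨diskBoundaryInclusion n v, v.2⟩ x
  · intro v x; exact x.elim
  · intro v _; exact c4 v

theorem exists_lift (hp : IsWeakSHomotopyEquiv p) {A : Flow} (hA : SCofibrant A) (f : FlowHom A Z) :
    ∃ g : FlowHom A Y, SHomotopy (p.comp g) f := by
  obtain ⟨inv, hinv⟩ := hp.1.2.hasRightInverse
  obtain ⟨G, hG⟩ := lift_Fl p _ _ hp.1.1 _ _ (fun u => u.elim) (cellLift_exist p hp.2) hA
    (Fl.mkHom p (ContinuousMap.const Empty PUnit.unit.{1}) (fun e => inv (f.toFun0 e))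
      (fun e => e.elim) (fun _ => f) (fun e => e.elim) (fun _ e => (hinv _).symm)
      (continuous_of_isEmpty _) (f.continuous_toFunP.comp continuous_fst) (fun e => e.elim))
  refine ⟨(Fl.evY p _ PUnit.unit).comp G, fun u => (Fl.evZ p _ u).comp G, ?_, ?_, ?_, ?_⟩
  · refine FlowHom.ext rfl ?_
    funext x
    exact (G.toFunP x).2.cj PUnit.unit
  · refine FlowHom.ext ?_ ?_
    · funext e
      have : G.toFun0 e = inv (f.toFun0 e) := hom_congr0 hG e
      change p.toFun0 (G.toFun0 e) = _
      rw [this]; exact hinv _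
    · funext x
      exact congrArg (Fl.evZ p (ContinuousMap.const Empty PUnit.unit.{1}) PUnit.unit).toFunP (hom_congrP hG x)
  · exact (Fl.continuous_evZ p _).comp ((G.continuous_toFunP.comp continuous_fst).prodMk continuous_snd)
  · exact (continuous_of_discreteTopology (f := fun e => p.toFun0 (G.toFun0 e))).comp continuous_fst
end exist

theorem glue {D W : Type} [TopologicalSpace D] [TopologicalSpace W] (C1 C2 : Set D) (h1 : IsClosed C1)
    (h2 : IsClosed C2) (hc : ∀ x, x ∈ C1 ∨ x ∈ C2) (f1 : C(C1, W)) (f2 : C(C2, W))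
    (he : ∀ x (a : x ∈ C1) (b : x ∈ C2), f1 ⟨x, a⟩ = f2 ⟨x, b⟩) :
    ∃ f : C(D, W), (∀ x (a : x ∈ C1), f x = f1 ⟨x, a⟩) ∧ (∀ x (b : x ∈ C2), f x = f2 ⟨x, b⟩) := by
  classical
  let f : D → W := fun x => if h : x ∈ C1 then f1 ⟨x, h⟩ else f2 ⟨x, (hc x).resolve_left h⟩
  have e1 : ∀ x (a : x ∈ C1), f x = f1 ⟨x, a⟩ := fun x a => dif_pos a
  have e2 : ∀ x (b : x ∈ C2), f x = f2 ⟨x, b⟩ := by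
    intro x b
    by_cases a : x ∈ C1
    · rw [e1 x a, he x a b]
    · exact dif_neg a
  have k1 : ContinuousOn f C1 := by
    rw [continuousOn_iff_continuous_domRestrict]
    exact f1.continuous.congr fun x => (e1 x.1 x.2).symm
  have k2 : ContinuousOn f C2 := by
    rw [continuousOn_iff_continuous_domRestrict]
    exact f2.continuous.congr fun x => (e2 x.1 x.2).symm
  have hf : Continuous f := by
    rw [← continuousOn_univ]
    have : (Set.univ : Set D) = C1 ∪ C2 := by ext x; simpa using hc x
    rw [this]
    exact k1.union_of_isClosed k2 h1 h2
  exact ⟨⟨f, hf⟩, e1, e2⟩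

section uniq
variable {Y Z : Flow} (p : FlowHom Y Z)

/-- endpoints of the interval -/
abbrev EndPt : Type := {x : I // x = 0 ∨ x = 1}

/-- three sides of the square -/
abbrev Sides : Type := {y : I × I // y.2 = 1 ∨ (y.1 = 0 ∨ y.1 = 1)}

theorem isClosed_endPt : IsClosed {x : I | x = 0 ∨ x = 1} :=
  (isClosed_singleton (x := (0 : I))).union (isClosed_singleton (x := (1 : I)))

theorem isClosed_sides : IsClosed {y : I × I | y.2 = 1 ∨ (y.1 = 0 ∨ y.1 = 1)} :=
  (isClosed_singleton.preimage continuous_snd).union (isClosed_endPt.preimage continuous_fst)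

instance : CompactSpace EndPt := isCompact_iff_compactSpace.1 isClosed_endPt.isCompact

instance : CompactSpace Sides := isCompact_iff_compactSpace.1 isClosed_sides.isCompact

instance : Finite EndPt := (Set.toFinite ({0, 1} : Set I)).to_subtype

instance : Nonempty Sides := ⟨⟨(0, 1), Or.inl rfl⟩⟩

/-- bottom edge -/
def bottom : C(I, I × I) := ⟨fun x => (x, 0), by fun_prop⟩
/-- bottom corners -/
def bottom' : C(EndPt, Sides) := ⟨fun x => ⟨(x.1, 0), Or.inr x.2⟩, by fun_prop⟩
/-- inclusion -/
def inclE : C(EndPt, I) := ⟨fun x => x.1, by fun_prop⟩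
/-- inclusion -/
def inclS : C(Sides, I × I) := ⟨fun x => x.1, by fun_prop⟩

theorem cellLift_uniq (hp : IsWeakHomotopyEquiv p.pathMap) :
    CellLift p bottom bottom' inclE inclS := by
  intro n αa βa αk βk h1 h2 h3 h4
  let D : Set (closedDisk n × I) :=
    {x : closedDisk n × I | x.1.1 ∈ Metric.sphere (0 : EuclideanSpace ℝ (Fin n)) 1 ∨ x.2 = 0 ∨ x.2 = 1}
  let D1 : Set D := {x | x.1.1.1 ∈ Metric.sphere (0 : EuclideanSpace ℝ (Fin n)) 1}
  let D2 : Set D := {x | x.1.2 = 0 ∨ x.1.2 = 1}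
  have hD1 : IsClosed D1 := Metric.isClosed_sphere.preimage (by fun_prop)
  have hD2 : IsClosed D2 := isClosed_endPt.preimage (by fun_prop)
  obtain ⟨a, ha1, ha2⟩ := glue D1 D2 hD1 hD2 (fun x => x.2)
    ⟨fun x => αa (⟨x.1.1.1.1, x.2⟩, x.1.1.2), by fun_prop⟩
    ⟨fun x => αk (x.1.1.1, ⟨x.1.1.2, x.2⟩), by fun_prop⟩
    (fun x u v => h3 ⟨x.1.1.1, u⟩ ⟨x.1.2, v⟩)
  let E1 : Set (D × I) := {x | x.1 ∈ D1}
  let E2 : Set (D × I) := {x | x.1 ∈ D2}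
  obtain ⟨H, hH1, hH2⟩ := glue E1 E2 (hD1.preimage continuous_fst) (hD2.preimage continuous_fst)
    (fun x => x.1.2)
    ⟨fun x => βa (⟨x.1.1.1.1.1, x.2⟩, (x.1.1.1.2, x.1.2)), by fun_prop⟩
    ⟨fun x => βk (x.1.1.1.1, ⟨(x.1.1.1.2, x.1.2), Or.inr x.2⟩), by fun_prop⟩
    (fun x u v => h4 ⟨x.1.1.1.1, u⟩ ⟨(x.1.1.2, x.2), Or.inr v⟩)
  obtain ⟨a', H', c1, c2, c3, c4⟩ := lift_disk_prod p.pathMap hp n a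
    ⟨fun x => βk (x.1, ⟨(x.2, 1), Or.inl rfl⟩), by fun_prop⟩ H (by
      intro s
      rcases s.2 with h | h
      · rw [ha1 s h, hH1 (s, 0) h]
        exact h1 ⟨s.1.1.1, h⟩ s.1.2
      · rw [ha2 s h, hH2 (s, 0) h]
        exact h2 s.1.1 ⟨s.1.2, h⟩) (by
      intro s
      rcases s.2 with h | h
      · rw [hH1 (s, 1) h]
        exact h4 ⟨s.1.1.1, h⟩ ⟨(s.1.2, 1), Or.inl rfl⟩
      · rw [hH2 (s, 1) h]
        rfl)
  refine ⟨a', ⟨fun x => H' ((x.1, x.2.1), x.2.2), by fun_prop⟩, ?_, ?_, ?_, ?_, ?_⟩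
  · intro v x; exact c3 (v, x)
  · intro v x
    have hm : (diskBoundaryInclusion n v, x) ∈ D := Or.inl v.2
    exact (c1 ⟨_, hm⟩).trans (ha1 ⟨_, hm⟩ v.2)
  · intro v x
    have hm : (diskBoundaryInclusion n v, x.1) ∈ D := Or.inl v.2
    exact (c2 ⟨_, hm⟩ x.2).trans (hH1 (⟨_, hm⟩, x.2) v.2)
  · intro v x
    have hm : (v, x.1) ∈ D := Or.inr x.2
    exact (c1 ⟨_, hm⟩).trans (ha2 ⟨_, hm⟩ x.2)
  · intro v x
    obtain ⟨⟨x, u⟩, h | h⟩ := x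
    · simp only at h
      subst h
      exact c4 (v, x)
    · have hm : (v, x) ∈ D := Or.inr h
      exact (c2 ⟨_, hm⟩ u).trans (hH2 (⟨_, hm⟩, u) h)

theorem unique_lift (hp : IsWeakSHomotopyEquiv p) {A : Flow} (hA : SCofibrant A) (g0 g1 : FlowHom A Y)
    (h : SHomotopy (p.comp g0) (p.comp g1)) : SHomotopy g0 g1 := by
  obtain ⟨K, K0, K1, Kc, Ks⟩ := h
  have hK : ∀ u e, (K u).toFun0 e = p.toFun0 (g0.toFun0 e) := by
    intro u e
    have hc : Continuous fun u : I => (K u).toFun0 e := Ks.comp (Continuous.prodMk_right e)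
    have : (K u).toFun0 e = (K 0).toFun0 e := PreconnectedSpace.constant inferInstance hc
    rw [this, K0]; rfl
  have h01 : ∀ e, g1.toFun0 e = g0.toFun0 e := by
    intro e
    apply hp.1.1
    rw [← hK 1 e, K1]; rfl
  classical
  let φ : EndPt → FlowHom A Y := fun x => if x.1 = 0 then g0 else g1
  have hφ0 : ∀ u e, (φ u).toFun0 e = g0.toFun0 e := by
    intro u e
    simp only [φ]; split
    · rfl
    · exact h01 e
  obtain ⟨G, hG⟩ := lift_Fl p bottom bottom' hp.1.1 inclE inclS (fun _ => rfl) (cellLift_uniq p hp.2) hA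
    (Fl.mkHom p bottom' g0.toFun0 φ (fun y => K y.1.1) hφ0 (fun y e => hK _ e)
      (continuous_prod_of_discrete_right.2 fun u => (φ u).continuous_toFunP)
      (Kc.comp (by fun_prop : Continuous fun x : A.Path × Sides => (x.1, x.2.1.1)))
      (by
        intro u x
        obtain ⟨u, rfl | rfl⟩ := u
        · change (K 0).toFunP x = p.toFunP ((if (0 : I) = 0 then g0 else g1).toFunP x)
          rw [if_pos rfl, K0]; rfl
        · change (K 1).toFunP x = p.toFunP ((if (1 : I) = 0 then g0 else g1).toFunP x)
          rw [if_neg one_ne_zero, K1]; rfl))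
  have hst : ∀ e, G.toFun0 e = g0.toFun0 e := fun e => hom_congr0 hG e
  refine ⟨fun u => (Fl.evY p _ u).comp G, ?_, ?_, ?_, ?_⟩
  · refine FlowHom.ext (funext hst) ?_
    funext x
    have := congrArg (Fl.evY p bottom' ⟨0, Or.inl rfl⟩).toFunP (hom_congrP hG x)
    refine this.trans ?_
    change (if (0 : I) = 0 then g0 else g1).toFunP x = _
    rw [if_pos rfl]
  · refine FlowHom.ext (funext fun e => (hst e).trans (h01 e).symm) ?_
    funext x
    have := congrArg (Fl.evY p bottom' ⟨1, Or.inr rfl⟩).toFunP (hom_congrP hG x)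
    refine this.trans ?_
    change (if (1 : I) = 0 then g0 else g1).toFunP x = _
    rw [if_neg one_ne_zero]
  · exact (Fl.continuous_evY p _).comp ((G.continuous_toFunP.comp continuous_fst).prodMk continuous_snd)
  · exact (continuous_of_discreteTopology (f := fun e => G.toFun0 e)).comp continuous_fst
end uniq

theorem cofibrant_equiv {X X' X'' : Flow} (h' : SCofibrant X') (h'' : SCofibrant X'')
    (f' : FlowHom X' X) (f'' : FlowHom X'' X) (hf' : IsWeakSHomotopyEquiv f')
    (hf'' : IsWeakSHomotopyEquiv f'') : SHomotopyEquivalent X' X'' := by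
  obtain ⟨g, hg⟩ := exists_lift f'' hf'' h' f'
  obtain ⟨k, hk⟩ := exists_lift f' hf' h'' f''
  refine ⟨g, k, ?_, ?_⟩
  · exact unique_lift f'' hf'' h'' _ _ ((hg.precomp k).trans hk)
  · exact unique_lift f' hf' h' _ _ ((hk.precomp g).trans hg)

end MyProof

/-- uniqueness of the S-cofibrant replacement up to S-homotopy: two
S-cofibrant flows equipped with weak S-homotopy equivalences to the same flow are
S-homotopy equivalent. -/
theorem sCofibrant_replacement_unique {X X' X'' : Flow}
    (h' : SCofibrant X') (h'' : SCofibrant X'')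
    (f' : FlowHom X' X) (f'' : FlowHom X'' X)
    (hw' : IsWeakSHomotopyEquiv f') (hw'' : IsWeakSHomotopyEquiv f'') :
    SHomotopyEquivalent X' X'' := by
  exact cofibrant_equiv h' h'' f' f'' hw' hw''

end Gaucher
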